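/- Let f ∈ ℤ[X,Y] be a binary form that has at least three pairwise non-proportional linear factors over ℂ, let k be a nonzero integer and p_1, ..., p_t distinct primes. Then the equation f(x,y) = k·p_1^{z_1}···p_t^{z_t} has only finitely many solutions (x, y, z_1, ..., z_t) ∈ ℤ^2 × ℕ^t with xy ≠ 0 and gcd(xy, p_1···p_t) = 1. -/

import Mathlib

open MvPolynomial

/-- homogenized evaluation -/
def hz (P : Polynomial ℤ) (D : ℕ) (x y : ℤ) : ℤ :=
  ∑ i ∈ Finset.range (D + 1), P.coeff i * x ^ i * y ^ (D - i)

lemma hz_cast (P : Polynomial ℤ) (D : ℕ) (x y : ℤ) (hP : P.natDegree ≤ D)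
    {L : Type*} [Field L] (hy : (y : L) ≠ 0) :
    ((hz P D x y : ℤ) : L) = (y : L) ^ D * Polynomial.aeval ((x : L) / y) P := by
  rw [Polynomial.aeval_eq_sum_range' (n := D + 1) (by omega), Finset.mul_sum, hz]
  push_cast
  refine Finset.sum_congr rfl fun i hi => ?_
  have hi' : i ≤ D := by simpa [Nat.lt_succ_iff] using hi
  obtain ⟨k, rfl⟩ := Nat.exists_eq_add_of_le hi'
  rw [zsmul_eq_mul, Nat.add_sub_cancel_left, div_pow, pow_add]
  field_simp

lemma powers_red (f : Polynomial ℤ) (hn : 1 ≤ f.natDegree) :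
    ∃ (c : ℕ → ℕ → ℤ) (B : ℕ), 1 ≤ B ∧ |f.leadingCoeff| ≤ B ∧ (∀ e l, |c e l| ≤ (B : ℤ) ^ e) ∧
      ∀ (L : Type) [Field L] (α : L), Polynomial.aeval α f = 0 → ∀ e,
        (f.leadingCoeff : L) ^ e * α ^ e = ∑ l ∈ Finset.range f.natDegree, (c e l : L) * α ^ l := by
  set n := f.natDegree with hnd
  set a := f.leadingCoeff with ha
  obtain ⟨F, hF⟩ : ∃ F : ℕ, ∀ l, |f.coeff l| ≤ F := by
    refine ⟨∑ l ∈ Finset.range (n+1), (f.coeff l).natAbs, fun l => ?_⟩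
    by_cases hl : l ≤ n
    · have := Finset.single_le_sum (f := fun l => (f.coeff l).natAbs) (s := Finset.range (n+1))
        (fun i _ => Nat.zero_le _) (Finset.mem_range.2 (Nat.lt_succ_of_le hl))
      rw [Int.abs_eq_natAbs]
      exact_mod_cast this
    · rw [Polynomial.coeff_eq_zero_of_natDegree_lt (by omega)]
      simp; positivity
  let c : ℕ → ℕ → ℤ := fun e => Nat.rec (fun l => if l = 0 then 1 else 0)
    (fun _ ce l => a * (if l = 0 then 0 else ce (l-1)) - ce (n-1) * f.coeff l) e
  have c0 : ∀ l, c 0 l = if l = 0 then 1 else 0 := fun l => rfl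
  have cs : ∀ e l, c (e+1) l = a * (if l = 0 then 0 else c e (l-1)) - c e (n-1) * f.coeff l :=
    fun e l => rfl
  clear_value c
  have hB0 : |a| ≤ F := hF n
  refine ⟨c, 2 * F + 1, by omega, by push_cast; linarith [abs_nonneg a], ?_, ?_⟩
  · intro e
    induction e with
    | zero => intro l; rw [c0]; split_ifs <;> simp
    | succ e ih =>
      intro l
      rw [cs]
      have hp : (0:ℤ) ≤ ((2 * F + 1 : ℕ) : ℤ) ^ e := by positivity
      have h1 : |a * (if l = 0 then 0 else c e (l-1))| ≤ F * ((2 * F + 1 : ℕ) : ℤ) ^ e := by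
        rw [abs_mul]
        refine mul_le_mul hB0 ?_ (abs_nonneg _) (by positivity)
        split_ifs
        · simpa using hp
        · exact ih _
      have h2 : |c e (n-1) * f.coeff l| ≤ ((2 * F + 1 : ℕ) : ℤ) ^ e * F := by
        rw [abs_mul]
        exact mul_le_mul (ih _) (hF l) (abs_nonneg _) hp
      refine (abs_sub _ _).trans ?_
      rw [pow_succ]
      push_cast at *
      nlinarith
  · intro L _ α hα e
    have hroot : (a : L) * α ^ n = - ∑ l ∈ Finset.range n, (f.coeff l : L) * α ^ l := by
      rw [Polynomial.aeval_eq_sum_range, Finset.sum_range_succ] at hα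
      simp only [zsmul_eq_mul] at hα
      have : (f.coeff f.natDegree) = a := rfl
      rw [this] at hα
      linear_combination hα
    induction e with
    | zero =>
      obtain ⟨k, hk⟩ := Nat.exists_eq_add_of_le hn
      rw [hk, add_comm, Finset.sum_range_succ']
      simp [c0]
    | succ e ih =>
      have : (a : L) ^ (e+1) * α ^ (e+1) = (a * α) * (a ^ e * α ^ e) := by ring
      rw [this, ih]
      obtain ⟨k, hk⟩ := Nat.exists_eq_add_of_le hn
      have hk' : n = k + 1 := by omega
      have h3 : ∑ l ∈ Finset.range n, (c (e+1) l : L) * α ^ l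
          = a * α * (∑ l ∈ Finset.range k, (c e l : L) * α ^ l)
            - (Int.cast (c e k) : L) * (∑ l ∈ Finset.range n, (f.coeff l : L) * α ^ l) := by
        simp only [cs]
        push_cast
        simp only [sub_mul, Finset.sum_sub_distrib]
        congr 1
        · rw [hk', Finset.sum_range_succ']
          simp
          rw [Finset.mul_sum]
          refine Finset.sum_congr rfl fun i _ => ?_
          ring
        · rw [Finset.mul_sum]
          refine Finset.sum_congr rfl fun i _ => ?_
          rw [hk']; simp only [Nat.add_sub_cancel]; ring
      rw [h3, ← neg_neg (∑ l ∈ Finset.range n, (f.coeff l : L) * α ^ l), ← hroot]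
      rw [hk', Finset.sum_range_succ]
      ring

attribute [local instance] Matrix.normedAddCommGroup in
lemma siegel_aux (f : Polynomial ℤ) (hn : 1 ≤ f.natDegree) (q : ℕ) (hq : 1 ≤ q) :
    ∃ E : ℝ, 1 ≤ E ∧ ∀ r : ℕ, 1 ≤ r → ∃ A B : Polynomial ℤ,
      (A ≠ 0 ∨ B ≠ 0) ∧ A.natDegree < f.natDegree * r * (q + 1) ∧
      B.natDegree < f.natDegree * r * (q + 1) ∧
      (∀ i, |(A.coeff i : ℝ)| ≤ E ^ r) ∧ (∀ i, |(B.coeff i : ℝ)| ≤ E ^ r) ∧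
      ∀ (L : Type) [Field L] [CharZero L] (α : L), Polynomial.aeval α f = 0 → ∀ j < 2 * q * r,
        Polynomial.aeval α (Polynomial.hasseDeriv j A) +
          α * Polynomial.aeval α (Polynomial.hasseDeriv j B) = 0 := by
  obtain ⟨c, B₀, hB₀, haB, hc, hroot⟩ := powers_red f hn
  set n := f.natDegree with hnd
  set a := f.leadingCoeff with ha
  have ha0 : a ≠ 0 := by
    rw [ha, Ne, Polynomial.leadingCoeff_eq_zero]
    rintro rfl
    simp at hnd; omega
  set E₀ : ℝ := 4 * (2 * B₀ * B₀) with hE₀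
  have hB₀' : (1:ℝ) ≤ B₀ := by exact_mod_cast hB₀
  have hE₀1 : 1 ≤ E₀ := by nlinarith
  refine ⟨E₀ ^ (n * (q+1) * q), one_le_pow₀ hE₀1, fun r hr => ?_⟩
  set D := n * r * (q + 1) with hD
  have hDpos : 0 < D := by positivity
  set M : Matrix (Fin (2 * q * r) × Fin n) (Fin 2 × Fin D) ℤ := fun u v =>
    ((v.2 : ℕ).choose u.1 : ℤ) * a ^ (D - ((v.2 : ℕ) - u.1 + v.1)) *
      c ((v.2 : ℕ) - u.1 + v.1) u.2 with hM
  have hcard1 : Fintype.card (Fin (2 * q * r) × Fin n) = 2 * q * r * n := by simp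
  have hcard2 : Fintype.card (Fin 2 × Fin D) = 2 * D := by simp
  have hDexp : 2 * D = 2 * q * r * n + 2 * (r * n) := by rw [hD]; ring
  have hrn : 0 < r * n := by positivity
  have hMnorm : ‖M‖ ≤ (2 * B₀ * B₀ : ℝ) ^ D := by
    rw [Matrix.norm_le_iff (by positivity)]
    rintro ⟨j, l⟩ ⟨b, i⟩
    have hi := i.2
    have hb := b.2
    have hle : (i : ℕ) - j + b ≤ D := by omega
    have h1 : (((i : ℕ).choose j : ℤ) : ℝ) ≤ 2 ^ D := by
      have : (i : ℕ).choose j ≤ 2 ^ (i : ℕ) := Nat.choose_le_two_pow _ _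
      have h2 : 2 ^ (i : ℕ) ≤ 2 ^ D := Nat.pow_le_pow_right (by norm_num) hi.le
      exact_mod_cast this.trans h2
    have h2 : |((a : ℤ) : ℝ)| ^ (D - ((i : ℕ) - j + b)) ≤ (B₀ : ℝ) ^ D := by
      have : |((a : ℤ) : ℝ)| ≤ B₀ := by exact_mod_cast haB
      exact (pow_le_pow_left₀ (abs_nonneg _) this _).trans
        (pow_le_pow_right₀ hB₀' (Nat.sub_le _ _))
    have h3 : |((c ((i : ℕ) - j + b) l : ℤ) : ℝ)| ≤ (B₀ : ℝ) ^ D := by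
      have : |((c ((i : ℕ) - j + b) l : ℤ) : ℝ)| ≤ (B₀ : ℝ) ^ ((i : ℕ) - j + b) := by
        exact_mod_cast hc ((i : ℕ) - j + b) l
      exact this.trans (pow_le_pow_right₀ hB₀' hle)
    simp only [hM, Int.norm_eq_abs]
    push_cast
    rw [abs_mul, abs_mul, abs_pow, mul_pow, mul_pow]
    gcongr
    rw [abs_of_nonneg (by positivity)]
    exact_mod_cast h1
  obtain ⟨t, ht0, htM, htn⟩ := Int.Matrix.exists_ne_zero_int_vec_norm_le M
    (by rw [hcard1, hcard2]; omega) (by rw [hcard1]; positivity)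
  have hexp : ((Fintype.card (Fin (2 * q * r) × Fin n) : ℕ) : ℝ) /
      (((Fintype.card (Fin 2 × Fin D) : ℕ) : ℝ) - ((Fintype.card (Fin (2 * q * r) × Fin n) : ℕ) : ℝ))
      = (q : ℝ) := by
    rw [hcard1, hcard2, hDexp]
    have : (0:ℝ) < r * n := by exact_mod_cast hrn
    push_cast
    rw [div_eq_iff (by nlinarith)]
    ring
  have hbound : ‖t‖ ≤ (E₀ ^ (n * (q+1) * q)) ^ r := by
    refine htn.trans ?_
    rw [hexp, Real.rpow_natCast]
    have h1 : (1:ℝ) ≤ (2 * B₀ * B₀ : ℝ) ^ D := one_le_pow₀ (by nlinarith)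
    have h2 : (((Fintype.card (Fin 2 × Fin D) : ℕ)) : ℝ) ≤ 4 ^ D := by
      rw [hcard2]
      have : 2 * D ≤ 4 ^ D := by
        have h := @Nat.lt_two_pow_self D
        have h' : 2 ≤ 2 ^ D := by
          calc 2 = 2 ^ 1 := rfl
            _ ≤ 2 ^ D := Nat.pow_le_pow_right (by norm_num) hDpos
        calc 2 * D ≤ 2 ^ D * 2 ^ D := Nat.mul_le_mul h' h.le
          _ = 4 ^ D := by rw [← mul_pow]; norm_num
      exact_mod_cast this
    calc ((((Fintype.card (Fin 2 × Fin D) : ℕ)) : ℝ) * max 1 ‖M‖) ^ q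
        ≤ (4 ^ D * (2 * B₀ * B₀ : ℝ) ^ D) ^ q := by
          gcongr
          exact max_le h1 hMnorm
      _ = (E₀ ^ (n * (q+1) * q)) ^ r := by
          rw [← mul_pow, ← pow_mul, ← pow_mul, hD, hE₀]
          congr 1; ring
  let Pb : Fin 2 → Polynomial ℤ := fun b => ∑ i : Fin D, Polynomial.monomial (i : ℕ) (t (b, i))
  have hcoef : ∀ b, ∀ i : Fin D, (Pb b).coeff i = t (b, i) := by
    intro b i
    simp only [Pb, Polynomial.finsetSum_coeff, Polynomial.coeff_monomial]
    rw [Finset.sum_eq_single i]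
    · simp
    · intro j _ hj
      rw [if_neg (by simpa [Fin.ext_iff] using hj)]
    · simp
  have hdeg : ∀ b, (Pb b).natDegree < D := by
    intro b
    have : (Pb b).natDegree ≤ D - 1 := by
      refine Polynomial.natDegree_sum_le_of_forall_le _ _ fun i _ => ?_
      refine (Polynomial.natDegree_monomial_le _).trans ?_
      have := i.2
      omega
    omega
  have hcb : ∀ b i, |((Pb b).coeff i : ℝ)| ≤ (E₀ ^ (n * (q+1) * q)) ^ r := by
    intro b i
    by_cases hi : i < D
    · have h := hcoef b ⟨i, hi⟩
      simp only at h
      rw [h]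
      have h1 := norm_le_pi_norm t (b, ⟨i, hi⟩)
      rw [Int.norm_eq_abs] at h1
      exact h1.trans hbound
    · rw [Polynomial.coeff_eq_zero_of_natDegree_lt (by have := hdeg b; omega)]
      simp; positivity
  refine ⟨Pb 0, Pb 1, ?_, hdeg 0, hdeg 1, hcb 0, hcb 1, ?_⟩
  · by_contra hcon
    push Not at hcon
    apply ht0
    ext ⟨b, i⟩
    rw [← hcoef]
    fin_cases b
    · simp [hcon.1]
    · simp [hcon.2]
  · intro L _ _ α hα j hj
    have haL : (a : L) ≠ 0 := by exact_mod_cast ha0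
    have hev : ∀ b, Polynomial.aeval α (Polynomial.hasseDeriv j (Pb b)) =
        ∑ i : Fin D, ((i : ℕ).choose j : L) * (t (b, i) : L) * α ^ ((i : ℕ) - j) := by
      intro b
      simp only [Pb, map_sum, Polynomial.hasseDeriv_monomial, Polynomial.aeval_monomial]
      simp
    have key : (a : L) ^ D * (Polynomial.aeval α (Polynomial.hasseDeriv j (Pb 0)) +
          α * Polynomial.aeval α (Polynomial.hasseDeriv j (Pb 1))) =
        ∑ l ∈ Finset.range n, (∑ b : Fin 2, ∑ i : Fin D,
          (((i : ℕ).choose j : ℤ) * a ^ (D - ((i : ℕ) - j + b)) *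
      c ((i : ℕ) - j + b) l * t (b, i) : ℤ)) * α ^ l := by
      have hterm : ∀ (b : Fin 2) (i : Fin D), (a : L) ^ D * (((i : ℕ).choose j : L) * (t (b, i) : L)
          * α ^ ((i : ℕ) - j + b)) = ∑ l ∈ Finset.range n, (((i : ℕ).choose j : L) *
            a ^ (D - ((i : ℕ) - j + b)) * c ((i : ℕ) - j + b) l * t (b, i)) * α ^ l := by
        intro b i
        have hi := i.2
        have hb := b.2
        have hle : (i : ℕ) - j + b ≤ D := by omega
        have : (a : L) ^ D = a ^ (D - ((i : ℕ) - j + b)) * a ^ ((i : ℕ) - j + b) := by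
          rw [← pow_add]; congr 1; omega
        rw [this]
        calc _ = ((i : ℕ).choose j : L) * a ^ (D - ((i : ℕ) - j + b)) * t (b, i) *
              (a ^ ((i : ℕ) - j + b) * α ^ ((i : ℕ) - j + b)) := by ring
          _ = _ := by
            rw [hroot L α hα, Finset.mul_sum]
            refine Finset.sum_congr rfl fun l _ => ?_
            ring
      have : (Polynomial.aeval α (Polynomial.hasseDeriv j (Pb 0)) +
          α * Polynomial.aeval α (Polynomial.hasseDeriv j (Pb 1))) =
          ∑ b : Fin 2, ∑ i : Fin D, (((i : ℕ).choose j : L) * (t (b, i) : L)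
          * α ^ ((i : ℕ) - j + b)) := by
        rw [Fin.sum_univ_two, hev, hev, Finset.mul_sum]
        congr 1
        refine Finset.sum_congr rfl fun i _ => ?_
        simp only [Fin.val_one, pow_succ]; ring
      rw [this, Finset.mul_sum]
      simp only [Finset.mul_sum, hterm]
      push_cast
      simp only [Finset.sum_mul]
      symm
      rw [Finset.sum_comm]
      refine Finset.sum_congr rfl fun b _ => ?_
      rw [Finset.sum_comm]
    have hz : (a : L) ^ D * (Polynomial.aeval α (Polynomial.hasseDeriv j (Pb 0)) +
          α * Polynomial.aeval α (Polynomial.hasseDeriv j (Pb 1))) = 0 := by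
      rw [key]
      refine Finset.sum_eq_zero fun l hl => ?_
      have hrow := congrFun htM (⟨j, hj⟩, ⟨l, Finset.mem_range.1 hl⟩)
      simp only [Matrix.mulVec, dotProduct, hM, Fintype.sum_prod_type, Pi.zero_apply] at hrow
      rw [hrow]; simp
    exact (mul_eq_zero.1 hz).resolve_left (pow_ne_zero _ haL)

lemma dvd_of_hasse {K : Type*} [Field K] (G : Polynomial K) (r : K) (m : ℕ)
    (h : ∀ j < m, Polynomial.eval r (Polynomial.hasseDeriv j G) = 0) :
    (Polynomial.X - Polynomial.C r) ^ m ∣ G := by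
  rw [Polynomial.X_sub_C_pow_dvd_iff, ← Polynomial.taylor_apply, Polynomial.X_pow_dvd_iff]
  intro j hj
  rw [Polynomial.taylor_coeff]
  exact h j hj

lemma wron_dvd {K : Type*} [Field K] (A B : Polynomial K) (r c : K) (s : ℕ)
    (h : (Polynomial.X - Polynomial.C r) ^ (s + 1) ∣ A + Polynomial.C c * B) :
    (Polynomial.X - Polynomial.C r) ^ s ∣ Polynomial.wronskian A B := by
  have h1 : Polynomial.wronskian A B = (A + Polynomial.C c * B) * Polynomial.derivative B -
      Polynomial.derivative (A + Polynomial.C c * B) * B := by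
    simp [Polynomial.wronskian]; ring
  rw [h1]
  refine dvd_sub (Dvd.dvd.mul_right ((pow_dvd_pow _ (Nat.le_succ s)).trans h) _) ?_
  exact Dvd.dvd.mul_right (Polynomial.pow_sub_one_dvd_derivative_of_pow_dvd h) _

lemma count_roots {K : Type*} [Field K] (W : Polynomial K) (hW : W ≠ 0) (s : Finset K)
    (k : K → ℕ) (h : ∀ r ∈ s, (Polynomial.X - Polynomial.C r) ^ (k r) ∣ W) :
    ∑ r ∈ s, k r ≤ W.natDegree := by
  have h1 : ∏ r ∈ s, (Polynomial.X - Polynomial.C r) ^ (k r) ∣ W := by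
    refine Finset.prod_dvd_of_coprime ?_ h
    intro a _ b _ hab
    exact (Polynomial.isCoprime_X_sub_C_of_isUnit_sub (sub_ne_zero.2 hab).isUnit).pow
  have h2 := Polynomial.natDegree_le_of_dvd h1 hW
  rw [Polynomial.natDegree_prod _ _ (fun r _ => pow_ne_zero _ (Polynomial.X_sub_C_ne_zero r))] at h2
  simpa using h2

lemma wron_ne_zero {K : Type*} [Field K] [CharZero K] (A B : Polynomial K) (hAB : A ≠ 0 ∨ B ≠ 0)
    (D m : ℕ)
    (hA : A.natDegree < D) (hB : B.natDegree < D) (s : Finset K)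
    (hs : ∀ α ∈ s, (Polynomial.X - Polynomial.C α) ^ m ∣ A + Polynomial.C α * B)
    (hD : D ≤ (s.card - 1) * m) : Polynomial.wronskian A B ≠ 0 := by
  classical
  intro hW
  set g := EuclideanDomain.gcd A B with hg
  have hg0 : g ≠ 0 := by
    intro h0
    rw [EuclideanDomain.gcd_eq_zero_iff] at h0
    tauto
  obtain ⟨A1, hA1⟩ := EuclideanDomain.gcd_dvd_left A B
  obtain ⟨B1, hB1⟩ := EuclideanDomain.gcd_dvd_right A B
  rw [← hg] at hA1 hB1
  have hcop : IsCoprime A1 B1 := by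
    refine ⟨EuclideanDomain.gcdA A B, EuclideanDomain.gcdB A B, ?_⟩
    have := EuclideanDomain.gcd_eq_gcd_ab A B
    rw [← hg] at this
    apply mul_left_cancel₀ hg0
    calc _ = (g * A1) * EuclideanDomain.gcdA A B + (g * B1) * EuclideanDomain.gcdB A B := by ring
      _ = g * 1 := by rw [← hA1, ← hB1, mul_one]; exact this.symm
  have hW1 : Polynomial.wronskian A1 B1 = 0 := by
    have : Polynomial.wronskian A B = g ^ 2 * Polynomial.wronskian A1 B1 := by
      rw [hA1, hB1]; simp [Polynomial.wronskian]; ring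
    rw [this] at hW
    exact (mul_eq_zero.1 hW).resolve_left (pow_ne_zero _ hg0)
  rw [hcop.wronskian_eq_zero_iff] at hW1
  have hA2 := Polynomial.eq_C_of_natDegree_eq_zero
    (Polynomial.derivative_eq_zero.1 hW1.1)
  have hB2 := Polynomial.eq_C_of_natDegree_eq_zero
    (Polynomial.derivative_eq_zero.1 hW1.2)
  set a := A1.coeff 0
  set b := B1.coeff 0
  have hab : a ≠ 0 ∨ b ≠ 0 := by
    by_contra hcon
    push Not at hcon
    rw [hA2, hB2, hcon.1, hcon.2] at hcop
    obtain ⟨u, v, h⟩ := hcop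
    simp at h
  have hgd : g.natDegree < D := by
    rcases hAB with h | h
    · exact (Polynomial.natDegree_le_of_dvd (EuclideanDomain.gcd_dvd_left A B) h).trans_lt hA
    · exact (Polynomial.natDegree_le_of_dvd (EuclideanDomain.gcd_dvd_right A B) h).trans_lt hB
  have hc := count_roots g hg0 (s.erase (-a / b)) (fun _ => m) (by
    intro r hr
    rw [Finset.mem_erase] at hr
    have h1 := hs r hr.2
    have hne : a + r * b ≠ 0 := by
      intro h0
      by_cases hb : b = 0
      · simp [hb] at h0; tauto
      · apply hr.1
        field_simp
        linear_combination h0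
    have h2 : A + Polynomial.C r * B = g * Polynomial.C (a + r * b) := by
      rw [hA1, hB1, hA2, hB2]; simp; ring
    rw [h2] at h1
    exact (IsUnit.dvd_mul_right (Polynomial.isUnit_C.2 hne.isUnit)).1 h1)
  rw [Finset.sum_const, smul_eq_mul] at hc
  have := Finset.pred_card_le_card_erase (s := s) (a := -a/b)
  have := Nat.mul_le_mul_right m this
  omega

lemma hasse_map {R S : Type*} [CommRing R] [CommRing S] (φ : R →+* S) (P : Polynomial R) (j : ℕ) :
    Polynomial.hasseDeriv j (P.map φ) = (Polynomial.hasseDeriv j P).map φ := by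
  ext i
  simp [Polynomial.hasseDeriv_coeff]

lemma eval_hasse {L : Type*} [Field L] (P : Polynomial ℤ) (j : ℕ) (x : L) :
    Polynomial.eval x (Polynomial.hasseDeriv j (P.map (Int.castRingHom L))) =
      Polynomial.aeval x (Polynomial.hasseDeriv j P) := by
  rw [hasse_map, Polynomial.eval_map, Polynomial.aeval_def]
  rfl

lemma eval_hasse_add {L : Type*} [Field L] (A B : Polynomial ℤ) (j : ℕ) (x c : L) :
    Polynomial.eval x (Polynomial.hasseDeriv j
      (A.map (Int.castRingHom L) + Polynomial.C c * B.map (Int.castRingHom L))) =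
      Polynomial.aeval x (Polynomial.hasseDeriv j A) +
        c * Polynomial.aeval x (Polynomial.hasseDeriv j B) := by
  rw [← Polynomial.smul_eq_C_mul, map_add, map_smul, Polynomial.eval_add, Polynomial.eval_smul,
    eval_hasse, eval_hasse, smul_eq_mul]

lemma exists_nonvanish (A B : Polynomial ℤ) (hAB : A ≠ 0 ∨ B ≠ 0) (D m : ℕ)
    (hA : A.natDegree < D) (hB : B.natDegree < D) (s : Finset ℂ)
    (hs : ∀ α ∈ s, ∀ j < m, Polynomial.aeval α (Polynomial.hasseDeriv j A) +
          α * Polynomial.aeval α (Polynomial.hasseDeriv j B) = 0)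
    (hD : D ≤ (s.card - 1) * m) (hm : 1 ≤ m) (ξ₁ ξ₂ : ℚ) (hξ : (ξ₁ : ℂ) ∉ s) :
    ∃ j, s.card * (m - 1) + j ≤ 2 * D ∧
      Polynomial.aeval ξ₁ (Polynomial.hasseDeriv j A) +
          ξ₂ * Polynomial.aeval ξ₁ (Polynomial.hasseDeriv j B) ≠ 0 := by
  classical
  by_contra hcon
  push Not at hcon
  set A' := A.map (Int.castRingHom ℂ) with hA'
  set B' := B.map (Int.castRingHom ℂ) with hB'
  have hinj : Function.Injective (Int.castRingHom ℂ) := Int.cast_injective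
  have hAd : A'.natDegree < D := by rwa [hA', Polynomial.natDegree_map_eq_of_injective hinj]
  have hBd : B'.natDegree < D := by rwa [hB', Polynomial.natDegree_map_eq_of_injective hinj]
  have hdiv : ∀ α ∈ s, (Polynomial.X - Polynomial.C α) ^ m ∣ A' + Polynomial.C α * B' := by
    intro α hα
    apply dvd_of_hasse
    intro j hj
    rw [eval_hasse_add]
    exact hs α hα j hj
  have hW := wron_ne_zero A' B' (by
    rcases hAB with h | h
    · left; rwa [hA', Ne, Polynomial.map_eq_zero_iff hinj]
    · right; rwa [hB', Ne, Polynomial.map_eq_zero_iff hinj]) D m hAd hBd s hdiv hD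
  have hWd := Polynomial.natDegree_wronskian_lt_add hW
  have hdivW : ∀ α ∈ s, (Polynomial.X - Polynomial.C α) ^ (m - 1) ∣ Polynomial.wronskian A' B' := by
    intro α hα
    apply wron_dvd A' B' α α
    rw [Nat.sub_add_cancel hm]
    exact hdiv α hα
  by_cases hcase : s.card * (m - 1) ≤ 2 * D
  · obtain ⟨J, hJ⟩ := Nat.exists_eq_add_of_le hcase
    have h1 : (Polynomial.X - Polynomial.C (ξ₁ : ℂ)) ^ (J + 1) ∣ A' + Polynomial.C (ξ₂ : ℂ) * B' := by
      apply dvd_of_hasse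
      intro j hj
      rw [eval_hasse_add]
      have h := hcon j (by omega)
      have h' := congrArg (algebraMap ℚ ℂ) h
      rw [map_add, map_mul, ← Polynomial.aeval_algebraMap_apply,
        ← Polynomial.aeval_algebraMap_apply, map_zero] at h'
      exact h'
    have h2 := wron_dvd _ _ _ _ _ h1
    have h3 := count_roots _ hW (insert (ξ₁ : ℂ) s) (fun r => if r = (ξ₁ : ℂ) then J else m - 1) (by
      intro r hr
      by_cases hr' : r = (ξ₁ : ℂ)
      · simp only [hr', if_true]; exact h2
      · simp only [hr', if_false]
        exact hdivW r ((Finset.mem_insert.1 hr).resolve_left hr'))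
    rw [Finset.sum_insert hξ, if_pos rfl, Finset.sum_congr rfl (g := fun _ => m - 1) (by
      intro r hr
      rw [if_neg]
      rintro rfl
      exact hξ hr), Finset.sum_const, smul_eq_mul] at h3
    omega
  · have h3 := count_roots _ hW s (fun r => m - 1) hdivW
    rw [Finset.sum_const, smul_eq_mul] at h3
    omega

lemma norm_int_le {L : Type*} [NormedField L] (z : ℤ) : ‖(z : L)‖ ≤ |(z : ℝ)| := by
  have h : ∀ k : ℕ, ‖(k : L)‖ ≤ k := fun k => by simpa using Nat.norm_cast_le (α := L) k
  rcases Int.natAbs_eq z with hz | hz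
  · rw [hz]; simpa using h z.natAbs
  · rw [hz]; simpa using h z.natAbs

lemma hasse_bound {L : Type*} [NormedField L] (P : Polynomial ℤ) (D : ℕ) (hP : P.natDegree < D)
    (Q R : ℝ) (hR : 1 ≤ R) (hQ : ∀ i, |(P.coeff i : ℝ)| ≤ Q) (α : L) (hα : ‖α‖ ≤ R) (i : ℕ) :
    ‖Polynomial.aeval α (Polynomial.hasseDeriv i P)‖ ≤ D * (2 ^ D * Q * R ^ D) := by
  have hQ0 : 0 ≤ Q := (abs_nonneg _).trans (hQ 0)
  have h1 : Polynomial.aeval α (Polynomial.hasseDeriv i P) =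
      ∑ k ∈ Finset.range D, ((k.choose i : ℕ) : L) * (P.coeff k : L) * α ^ (k - i) := by
    conv_lhs => rw [Polynomial.as_sum_range' P D hP]
    simp only [map_sum, Polynomial.hasseDeriv_monomial, Polynomial.aeval_monomial]
    simp
  rw [h1]
  refine (norm_sum_le _ _).trans ?_
  rw [show (D : ℝ) * (2 ^ D * Q * R ^ D) = ∑ k ∈ Finset.range D, (2 ^ D * Q * R ^ D) by simp]
  refine Finset.sum_le_sum fun k hk => ?_
  have hk' := Finset.mem_range.1 hk
  rw [norm_mul, norm_mul, norm_pow]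
  have a1 : ‖((k.choose i : ℕ) : L)‖ ≤ 2 ^ D := by
    have h2 := norm_int_le (L := L) (k.choose i : ℤ)
    have h3 : k.choose i ≤ 2 ^ D := (Nat.choose_le_two_pow _ _).trans
      (Nat.pow_le_pow_right (by norm_num) hk'.le)
    have h4 : (k.choose i : ℝ) ≤ 2 ^ D := by exact_mod_cast h3
    have h5 : ‖((k.choose i : ℕ) : L)‖ ≤ (k.choose i : ℝ) := by simpa using h2
    exact h5.trans h4
  have a2 := (norm_int_le (L := L) (P.coeff k)).trans (hQ k)
  have a3 : ‖α‖ ^ (k - i) ≤ R ^ D :=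
    (pow_le_pow_left₀ (norm_nonneg _) hα _).trans (pow_le_pow_right₀ hR (by omega))
  gcongr

lemma taylor_hasse {L : Type*} [Field L] (P : Polynomial ℤ) (D : ℕ) (hP : P.natDegree < D)
    (j : ℕ) (α ξ : L) :
    Polynomial.aeval ξ (Polynomial.hasseDeriv j P) = ∑ s ∈ Finset.range D,
      (((s + j).choose s : ℕ) : L) * Polynomial.aeval α (Polynomial.hasseDeriv (s + j) P) *
        (ξ - α) ^ s := by
  rw [← eval_hasse, ← Polynomial.taylor_eval_sub α, Polynomial.eval_eq_sum_range' (n := D)]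
  · refine Finset.sum_congr rfl fun s _ => ?_
    congr 1
    rw [Polynomial.taylor_coeff, ← LinearMap.comp_apply, Polynomial.hasseDeriv_comp,
      LinearMap.smul_apply, Polynomial.eval_smul, eval_hasse, nsmul_eq_mul]
  · rw [Polynomial.natDegree_taylor]
    refine (Polynomial.natDegree_hasseDeriv_le _ _).trans_lt ?_
    have := Polynomial.natDegree_map_le (f := Int.castRingHom L) (p := P)
    omega

lemma main_bound {L : Type*} [NormedField L] (A B : Polynomial ℤ) (D m j : ℕ)
    (hA : A.natDegree < D) (hB : B.natDegree < D) (Q R : ℝ) (hR : 1 ≤ R)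
    (hAQ : ∀ i, |(A.coeff i : ℝ)| ≤ Q) (hBQ : ∀ i, |(B.coeff i : ℝ)| ≤ Q)
    (α : L) (hα : ‖α‖ ≤ R)
    (hroot : ∀ j < m, Polynomial.aeval α (Polynomial.hasseDeriv j A) +
          α * Polynomial.aeval α (Polynomial.hasseDeriv j B) = 0)
    (x₁ y₁ x₂ y₂ : L) (hy₁ : y₁ ≠ 0) (hy₂ : y₂ ≠ 0) (h₁ h₂ δ₁ δ₂ : ℝ)
    (hy₁' : ‖y₁‖ ≤ h₁) (hy₂' : ‖y₂‖ ≤ h₂) (hδ₁ : 0 ≤ δ₁) (hδ₁' : δ₁ ≤ 1) (hδ₂ : 0 ≤ δ₂)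
    (hx₁ : ‖x₁ - α * y₁‖ ≤ R * δ₁ * h₁) (hx₂ : ‖x₂ - α * y₂‖ ≤ R * δ₂ * h₂)
    (μ : ℝ) (hμ₁ : δ₁ ^ (m - j) ≤ μ) (hμ₂ : δ₂ ≤ μ) :
    ‖y₁ ^ D * y₂ * (Polynomial.aeval (x₁ / y₁) (Polynomial.hasseDeriv j A) +
          x₂ / y₂ * Polynomial.aeval (x₁ / y₁) (Polynomial.hasseDeriv j B))‖ ≤
      (48 * R ^ 3) ^ D * Q * h₁ ^ D * h₂ * μ := by
  have hQ0 : 0 ≤ Q := (abs_nonneg _).trans (hAQ 0)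
  have hh₁ : 0 ≤ h₁ := (norm_nonneg _).trans hy₁'
  have hh₂ : 0 ≤ h₂ := (norm_nonneg _).trans hy₂'
  have hμ0 : 0 ≤ μ := hδ₂.trans hμ₂
  set a : ℕ → L := fun i => Polynomial.aeval α (Polynomial.hasseDeriv i A) with ha
  set b : ℕ → L := fun i => Polynomial.aeval α (Polynomial.hasseDeriv i B) with hb
  set T : ℝ := D * (2 ^ D * Q * R ^ D) with hT
  have hT0 : 0 ≤ T := by positivity
  have haT : ∀ i, ‖a i‖ ≤ T := fun i => hasse_bound A D hA Q R hR hAQ α hα i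
  have hbT : ∀ i, ‖b i‖ ≤ T := fun i => hasse_bound B D hB Q R hR hBQ α hα i
  have hb0 : ∀ i, D ≤ i → b i = 0 := fun i hi => by
    simp only [hb]
    rw [Polynomial.hasseDeriv_eq_zero_of_lt_natDegree _ _ (by omega)]; simp
  have ha0 : ∀ i, D ≤ i → a i = 0 := fun i hi => by
    simp only [ha]
    rw [Polynomial.hasseDeriv_eq_zero_of_lt_natDegree _ _ (by omega)]; simp
  set w : ℕ → L := fun s => (((s + j).choose s : ℕ) : L) * (y₁ ^ D * (x₁ / y₁ - α) ^ s) with hw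
  have hwb : ∀ s, s < D → s + j < D → ‖w s‖ ≤ 2 ^ D * (h₁ ^ D * R ^ D * δ₁ ^ s) := by
    intro s hs hsj
    have e1 : y₁ ^ D * (x₁ / y₁ - α) ^ s = y₁ ^ (D - s) * (x₁ - α * y₁) ^ s := by
      obtain ⟨k, rfl⟩ := Nat.exists_eq_add_of_lt hs
      rw [show s + k + 1 - s = k + 1 by omega, show x₁ - α * y₁ = (x₁ / y₁ - α) * y₁ by
        field_simp, mul_pow]
      ring
    have e2 : ‖(((s + j).choose s : ℕ) : L)‖ ≤ 2 ^ D := by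
      have h2 := norm_int_le (L := L) ((s+j).choose s : ℤ)
      have h3 : (s+j).choose s ≤ 2 ^ D := (Nat.choose_le_two_pow _ _).trans
        (Nat.pow_le_pow_right (by norm_num) hsj.le)
      have h4 : ((s+j).choose s : ℝ) ≤ 2 ^ D := by exact_mod_cast h3
      have h5 : ‖(((s+j).choose s : ℕ) : L)‖ ≤ ((s+j).choose s : ℝ) := by simpa using h2
      exact h5.trans h4
    simp only [hw]
    rw [norm_mul, e1, norm_mul, norm_pow, norm_pow]
    refine mul_le_mul e2 ?_ (by positivity) (by positivity)
    calc ‖y₁‖ ^ (D - s) * ‖x₁ - α * y₁‖ ^ s ≤ h₁ ^ (D - s) * (R * δ₁ * h₁) ^ s := by gcongr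
      _ = h₁ ^ D * R ^ s * δ₁ ^ s := by
        have : h₁ ^ D = h₁ ^ (D - s) * h₁ ^ s := by rw [← pow_add]; congr 1; omega
        rw [this]; ring
      _ ≤ h₁ ^ D * R ^ D * δ₁ ^ s := by gcongr
  have key : y₁ ^ D * y₂ * (Polynomial.aeval (x₁ / y₁) (Polynomial.hasseDeriv j A) +
          x₂ / y₂ * Polynomial.aeval (x₁ / y₁) (Polynomial.hasseDeriv j B)) =
      ∑ s ∈ Finset.range D, (y₂ * ((a (s + j) + α * b (s + j)) * w s) +
        (x₂ - α * y₂) * (b (s + j) * w s)) := by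
    rw [taylor_hasse A D hA j α, taylor_hasse B D hB j α, Finset.mul_sum, ← Finset.sum_add_distrib,
      Finset.mul_sum]
    refine Finset.sum_congr rfl fun s _ => ?_
    simp only [ha, hb, hw]
    field_simp
    ring
  rw [key]
  refine (norm_sum_le _ _).trans ?_
  have hterm : ∀ s ∈ Finset.range D, ‖y₂ * ((a (s + j) + α * b (s + j)) * w s) +
        (x₂ - α * y₂) * (b (s + j) * w s)‖ ≤ 3 * R * T * 2 ^ D * R ^ D * h₁ ^ D * h₂ * μ := by
    intro s hs
    rw [Finset.mem_range] at hs
    by_cases hsj : s + j < D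
    · have hw1 := hwb s hs hsj
      have hone : δ₁ ^ s ≤ 1 := pow_le_one₀ hδ₁ hδ₁'
      have hw2 : ‖w s‖ ≤ 2 ^ D * (h₁ ^ D * R ^ D) :=
        hw1.trans (by
          have : h₁ ^ D * R ^ D * δ₁ ^ s ≤ h₁ ^ D * R ^ D * 1 := by gcongr
          rw [mul_one] at this
          gcongr)
      have t2 : ‖(x₂ - α * y₂) * (b (s + j) * w s)‖ ≤
          (R * μ * h₂) * (T * (2 ^ D * (h₁ ^ D * R ^ D))) := by
        rw [norm_mul, norm_mul]
        have : ‖x₂ - α * y₂‖ ≤ R * μ * h₂ := hx₂.trans (by gcongr)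
        have := hbT (s + j)
        gcongr
      have t1 : ‖y₂ * ((a (s + j) + α * b (s + j)) * w s)‖ ≤
          h₂ * ((2 * R * T) * (2 ^ D * (h₁ ^ D * R ^ D * μ))) := by
        by_cases hm : s + j < m
        · simp only [ha, hb]
          rw [hroot _ hm]; simp; positivity
        · rw [norm_mul, norm_mul]
          have g1 : ‖a (s + j) + α * b (s + j)‖ ≤ 2 * R * T := by
            refine (norm_add_le _ _).trans ?_
            rw [norm_mul]
            have := haT (s + j)
            have : ‖α‖ * ‖b (s + j)‖ ≤ R * T := mul_le_mul hα (hbT _) (norm_nonneg _) (by linarith)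
            nlinarith
          have g2 : δ₁ ^ s ≤ μ := (pow_le_pow_of_le_one hδ₁ hδ₁' (by omega)).trans hμ₁
          have g3 : ‖w s‖ ≤ 2 ^ D * (h₁ ^ D * R ^ D * μ) := hw1.trans (by gcongr)
          gcongr
      refine (norm_add_le _ _).trans ((add_le_add t1 t2).trans (le_of_eq ?_))
      ring
    · rw [ha0 _ (by omega), hb0 _ (by omega)]
      simp; positivity
  refine (Finset.sum_le_sum hterm).trans ?_
  rw [Finset.sum_const, Finset.card_range, nsmul_eq_mul, hT]
  have hD1 : 1 ≤ D := by omega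
  have hD2 : (D : ℝ) ≤ 2 ^ D := by exact_mod_cast (Nat.lt_two_pow_self (n := D)).le
  have hRD : R ≤ R ^ D := le_self_pow₀ hR (by omega)
  have h3D : (3:ℝ) ≤ 3 ^ D := le_self_pow₀ (by norm_num) (by omega)
  calc (D : ℝ) * (3 * R * (D * (2 ^ D * Q * R ^ D)) * 2 ^ D * R ^ D * h₁ ^ D * h₂ * μ)
      ≤ (2 ^ D : ℝ) * (3 ^ D * R ^ D * (2 ^ D * (2 ^ D * Q * R ^ D)) * 2 ^ D * R ^ D * h₁ ^ D * h₂ * μ) := by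
        gcongr
    _ = (48 * R ^ 3) ^ D * Q * h₁ ^ D * h₂ * μ := by
        rw [show (48:ℝ) = 2 * 2 * 2 * 2 * 3 by norm_num]
        simp only [mul_pow]
        ring

lemma local_root {L : Type*} [NormedField L] [IsAlgClosed L] [CharZero L] (f : Polynomial ℤ)
    (hn : 1 ≤ f.natDegree) (hsep : (f.map (Int.castRingHom L)).Separable) :
    ∃ C : ℝ, 1 ≤ C ∧ ∀ x y : L, y ≠ 0 → ∃ α : L, Polynomial.aeval α f = 0 ∧
      ‖x - α * y‖ * (max ‖x‖ ‖y‖) ^ (f.natDegree - 1) ≤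
        C * ‖y ^ f.natDegree * Polynomial.aeval (x / y) f‖ := by
  classical
  set g := f.map (Int.castRingHom L) with hg
  have hinj : Function.Injective (Int.castRingHom L) := Int.cast_injective
  have hdeg : g.natDegree = f.natDegree := Polynomial.natDegree_map_eq_of_injective hinj f
  have hg0 : g ≠ 0 := by
    rintro h0; rw [h0] at hdeg; simp at hdeg; omega
  have hspl : g.Splits := IsAlgClosed.splits g
  have hnod : g.roots.Nodup := Polynomial.nodup_roots hsep
  set s := g.roots.toFinset with hs
  have hcard : s.card = f.natDegree := by
    rw [hs, Multiset.toFinset_card_of_nodup hnod, ← hspl.natDegree_eq_card_roots, hdeg]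
  have haev : ∀ z : L, Polynomial.aeval z f = Polynomial.eval z g := fun z => by
    rw [hg, Polynomial.eval_map, Polynomial.aeval_def]; rfl
  have hprod : ∀ z : L, Polynomial.eval z g = g.leadingCoeff * ∏ α ∈ s, (z - α) := by
    intro z
    rw [hspl.eval_eq_prod_roots z, Finset.prod, hs, Multiset.toFinset_val, hnod.dedup]
  have hlc : 0 < ‖g.leadingCoeff‖ := norm_pos_iff.2 (Polynomial.leadingCoeff_ne_zero.2 hg0)
  obtain ⟨R, hR⟩ : ∃ R : ℝ, ∀ α ∈ s, ‖α‖ ≤ R := by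
    obtain ⟨R, hR⟩ := (s.image (fun α => ‖α‖)).bddAbove
    exact ⟨R, fun α hα => hR (by simpa using ⟨α, hα, rfl⟩)⟩
  set R' := max R 1
  have hR1 : 1 ≤ R' := le_max_right _ _
  have hR' : ∀ α ∈ s, ‖α‖ ≤ R' := fun α hα => (hR α hα).trans (le_max_left _ _)
  obtain ⟨K, hK⟩ : ∃ K : ℝ, ∀ α ∈ s, ∀ β ∈ s, 2 * R' / ‖α - β‖ ≤ K := by
    obtain ⟨K, hK⟩ := ((s ×ˢ s).image (fun p : L × L => 2 * R' / ‖p.1 - p.2‖)).bddAbove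
    refine ⟨K, fun α hα β hβ => hK ?_⟩
    simp only [Finset.coe_image, Set.mem_image]
    exact ⟨(α, β), by simp [hα, hβ], rfl⟩
  set K' := max K 1
  have hK1 : 1 ≤ K' := le_max_right _ _
  have hK' : ∀ α ∈ s, ∀ β ∈ s, α ≠ β → 2 * R' ≤ K' * ‖α - β‖ := by
    intro α hα β hβ hne
    have hpos : 0 < ‖α - β‖ := norm_pos_iff.2 (sub_ne_zero.2 hne)
    rw [← div_le_iff₀ hpos]
    exact (hK α hα β hβ).trans (le_max_left _ _)
  refine ⟨max 1 (K' ^ (f.natDegree - 1) / ‖g.leadingCoeff‖), le_max_left _ _, fun x y hy => ?_⟩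
  have hsne : s.Nonempty := Finset.card_pos.1 (by omega)
  obtain ⟨α₀, hα₀, hmin⟩ := s.exists_min_image (fun α => ‖x - α * y‖) hsne
  refine ⟨α₀, ?_, ?_⟩
  · rw [haev]
    have := (Polynomial.mem_roots hg0).1 (Multiset.mem_toFinset.1 hα₀)
    exact this
  have hF : y ^ f.natDegree * Polynomial.aeval (x / y) f =
      g.leadingCoeff * ∏ α ∈ s, (x - α * y) := by
    rw [haev, hprod, ← hcard, ← Finset.prod_const, mul_left_comm, ← Finset.prod_mul_distrib]
    congr 1
    refine Finset.prod_congr rfl fun α _ => ?_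
    field_simp
  have hoth : ∀ α ∈ s.erase α₀, max ‖x‖ ‖y‖ ≤ K' * ‖x - α * y‖ := by
    intro α hα
    rw [Finset.mem_erase] at hα
    have hle := hmin α hα.2
    have hsep' := hK' α₀ hα₀ α hα.2 hα.1.symm
    have hpos : 0 < ‖α₀ - α‖ := norm_pos_iff.2 (sub_ne_zero.2 hα.1.symm)
    have e1 : ‖α₀ - α‖ * ‖y‖ ≤ 2 * R' * ‖x - α * y‖ := by
      rw [← norm_mul, show (α₀ - α) * y = (x - α * y) - (x - α₀ * y) by ring]
      refine (norm_sub_le _ _).trans ?_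
      nlinarith [norm_nonneg (x - α * y)]
    have e2 : ‖α₀ - α‖ * ‖x‖ ≤ 2 * R' * ‖x - α * y‖ := by
      rw [← norm_mul, show (α₀ - α) * x = α₀ * (x - α * y) - α * (x - α₀ * y) by ring]
      refine (norm_sub_le _ _).trans ?_
      rw [norm_mul, norm_mul]
      have := mul_le_mul (hR' α₀ hα₀) le_rfl (norm_nonneg (x - α * y)) (by linarith)
      have := mul_le_mul (hR' α hα.2) hle (norm_nonneg (x - α₀ * y)) (by linarith)
      linarith
    have e3 : ‖α₀ - α‖ * max ‖x‖ ‖y‖ ≤ 2 * R' * ‖x - α * y‖ := by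
      rcases max_choice ‖x‖ ‖y‖ with h | h <;> rw [h] <;> assumption
    have e4 : ‖α₀ - α‖ * max ‖x‖ ‖y‖ ≤ ‖α₀ - α‖ * (K' * ‖x - α * y‖) := by
      refine e3.trans ?_
      nlinarith [norm_nonneg (x - α * y)]
    exact le_of_mul_le_mul_left e4 hpos
  have hpow : (max ‖x‖ ‖y‖) ^ (f.natDegree - 1) ≤
      K' ^ (f.natDegree - 1) * ∏ α ∈ s.erase α₀, ‖x - α * y‖ := by
    have hc : (s.erase α₀).card = f.natDegree - 1 := by rw [Finset.card_erase_of_mem hα₀, hcard]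
    rw [← hc, ← Finset.prod_const, ← Finset.prod_const, ← Finset.prod_mul_distrib]
    exact Finset.prod_le_prod (fun _ _ => by positivity) hoth
  rw [hF, norm_mul, norm_prod, ← Finset.mul_prod_erase s _ hα₀]
  calc ‖x - α₀ * y‖ * (max ‖x‖ ‖y‖) ^ (f.natDegree - 1)
      ≤ ‖x - α₀ * y‖ * (K' ^ (f.natDegree - 1) * ∏ α ∈ s.erase α₀, ‖x - α * y‖) := by gcongr
    _ = (K' ^ (f.natDegree - 1) / ‖g.leadingCoeff‖) *
        (‖g.leadingCoeff‖ * (‖x - α₀ * y‖ * ∏ α ∈ s.erase α₀, ‖x - α * y‖)) := by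
        field_simp
    _ ≤ _ := by
        gcongr
        exact le_max_right _ _

lemma arith_aux (n q τ M r w S : ℤ) (hn : 3 ≤ n) (hq : q = 2 * n ^ 2 + n + 2) (hτ : 1 ≤ τ)
    (hM : M = 2 * q * τ) (hr : 0 ≤ r) (hS : n * M ≤ S + τ) (hw : 2 * q * r - (2 * n * r + n) ≤ w)
    (hw0 : 0 ≤ w) :
    r * M + n * r * (q + 1) * M + (2 * q * (r + 1)) * M ≤ w * S + (n * n * M + 2 * q * M) := by
  have hqn : n ≤ q := by nlinarith
  have hM0 : 0 ≤ M := by rw [hM]; nlinarith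
  have hMτ : 2 * q * τ ≤ M := hM.ge
  have h0 : 0 ≤ n * M - τ := by nlinarith
  have h1 : w * (n * M - τ) ≤ w * S := mul_le_mul_of_nonneg_left (by linarith) hw0
  have h2 : (2 * q * r - (2 * n * r + n)) * (n * M - τ) ≤ w * (n * M - τ) :=
    mul_le_mul_of_nonneg_right hw h0
  have h3 : 1 ≤ (n - 2) * q - 2 * n ^ 2 - n - 1 := by nlinarith
  have h4 : 0 ≤ M * ((n - 2) * q - 2 * n ^ 2 - n - 1) - 2 * (q - n) * τ := by nlinarith
  have h5 := mul_nonneg hr h4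
  have h6 : 0 ≤ n * τ := by nlinarith
  nlinarith

/-- data of an approximating pair -/
def GoodPair {ι : Type} [Fintype ι] (L : ι → Type) [∀ v, NormedField (L v)] (f : Polynomial ℤ)
    (α : ∀ v, L v) (R : ℝ) (M : ℕ) (e : ι → ℕ) (x y : ℤ) : Prop :=
  y ≠ 0 ∧ Polynomial.aeval ((x : ℚ) / y) f ≠ 0 ∧
  (∀ v, 1 ≤ max ‖(x : L v)‖ ‖(y : L v)‖) ∧
  ∃ δ : ι → ℝ, ∀ v, 0 ≤ δ v ∧ δ v ≤ 1 ∧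
    ‖(x : L v) - α v * y‖ ≤ R * δ v * max ‖(x : L v)‖ ‖(y : L v)‖ ∧
    (∏ u, max ‖(x : L u)‖ ‖(y : L u)‖) ^ (e v) * δ v ^ M ≤ 1

set_option maxHeartbeats 1000000 in
lemma core_bound {ι : Type} [Fintype ι] (L : ι → Type) [∀ v, NormedField (L v)]
    [∀ v, CharZero (L v)] (hprod : ∀ N : ℤ, N ≠ 0 → 1 ≤ ∏ v, ‖(N : L v)‖)
    (f : Polynomial ℤ) (hn : 3 ≤ f.natDegree) (s : Finset ℂ)
    (hs : ∀ z, z ∈ s ↔ Polynomial.aeval z f = 0) (hscard : s.card = f.natDegree)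
    (α : ∀ v, L v) (hα : ∀ v, Polynomial.aeval (α v) f = 0) (R : ℝ) (hR : 1 ≤ R)
    (hαR : ∀ v, ‖α v‖ ≤ R) (q M : ℕ) (hq : q = 2 * f.natDegree ^ 2 + f.natDegree + 2)
    (hM : M = 2 * q * (Fintype.card ι + 1)) (e : ι → ℕ)
    (he : f.natDegree * M ≤ ∑ v, e v + (Fintype.card ι + 1)) :
    ∃ Bd : ℝ, ∀ x y : ℤ, GoodPair L f α R M e x y →
      ∏ v, max ‖(x : L v)‖ ‖(y : L v)‖ ≤ Bd := by
  by_contra hcon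
  push Not at hcon
  set n := f.natDegree with hnd
  set T := Fintype.card ι with hT
  obtain ⟨E, hE1, hE⟩ := siegel_aux f (by omega) q (by omega)
  set C : ℝ := (48 * R ^ 3) ^ (n * (q + 1)) * E with hC
  have hC1 : 1 ≤ C := by
    have : (1:ℝ) ≤ 48 * R ^ 3 := by nlinarith [one_le_pow₀ hR (n := 3)]
    exact one_le_mul_of_one_le_of_one_le (one_le_pow₀ this) hE1
  clear_value C
  obtain ⟨x₁, y₁, hg₁, hH₁⟩ := hcon (2 * C ^ T)
  set H₁ := ∏ v, max ‖(x₁ : L v)‖ ‖(y₁ : L v)‖ with hH₁d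
  have hH₁2 : 2 ≤ H₁ := by nlinarith [one_le_pow₀ hC1 (n := T)]
  have hH₁1 : 1 ≤ H₁ := by linarith
  set K₀ := n * n * M + 2 * q * M with hK₀
  obtain ⟨r₀, hr₀⟩ := pow_unbounded_of_one_lt (H₁ ^ K₀) (by norm_num : (1:ℝ) < 2)
  obtain ⟨x₂, y₂, hg₂, hH₂⟩ := hcon ((H₁ ^ (2 * q)) ^ (r₀ + 1))
  set H₂ := ∏ v, max ‖(x₂ : L v)‖ ‖(y₂ : L v)‖ with hH₂d
  have hbase : 1 < H₁ ^ (2 * q) := one_lt_pow₀ (by linarith) (by omega)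
  have hH₂1 : 1 ≤ H₂ := (one_le_pow₀ hbase.le).trans hH₂.le
  obtain ⟨r, hr1, hr2⟩ := exists_nat_pow_near hH₂1 hbase
  have hrr : r₀ + 1 ≤ r := by
    have := (pow_lt_pow_iff_right₀ hbase).1 (hH₂.trans hr2)
    omega
  obtain ⟨A, B, hAB, hAd, hBd, hAE, hBE, hroot⟩ := hE r (by omega)
  set D := n * r * (q + 1) with hD
  obtain ⟨hy₁, hf₁, hh₁, δ₁, hδ₁⟩ := hg₁
  obtain ⟨hy₂, hf₂, hh₂, δ₂, hδ₂⟩ := hg₂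
  clear_value D K₀
  simp only [← hH₁d] at hδ₁
  simp only [← hH₂d] at hδ₂
  clear_value H₁ H₂ n T
  obtain ⟨j, hj, hjne⟩ := exists_nonvanish A B hAB D (2 * q * r) hAd hBd s
    (fun z hz => hroot ℂ z ((hs z).1 hz)) (by
      rw [hscard, hD]
      obtain ⟨k, hk⟩ := Nat.exists_eq_add_of_le hn
      have h1 : n - 1 = k + 2 := by omega
      rw [h1]
      have h2 : n * (q + 1) ≤ (k + 2) * (2 * q) := by
        have : n ≤ q := by nlinarith
        rw [hk] at this ⊢
        nlinarith
      calc n * r * (q + 1) = n * (q + 1) * r := by ring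
        _ ≤ (k + 2) * (2 * q) * r := Nat.mul_le_mul_right r h2
        _ = (k + 2) * (2 * q * r) := by ring) (by
      have : 1 ≤ q * r := Nat.mul_pos (by omega) (by omega)
      nlinarith)
    ((x₁ : ℚ) / y₁) ((x₂ : ℚ) / y₂) (by
      rw [hs]
      intro h0
      apply hf₁
      have h1 : ((((x₁ : ℚ) / y₁ : ℚ)) : ℂ) = algebraMap ℚ ℂ ((x₁ : ℚ) / y₁) := rfl
      rw [h1, Polynomial.aeval_algebraMap_apply] at h0
      exact (map_eq_zero _).1 h0)
  set N : ℤ := hz (Polynomial.hasseDeriv j A) D x₁ y₁ * y₂ +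
    hz (Polynomial.hasseDeriv j B) D x₁ y₁ * x₂ with hN
  have hNcast : ∀ (F : Type) [Field F] [CharZero F], (N : F) = (y₁ : F) ^ D * y₂ *
      (Polynomial.aeval ((x₁ : F) / y₁) (Polynomial.hasseDeriv j A) +
          (x₂ : F) / y₂ * Polynomial.aeval ((x₁ : F) / y₁) (Polynomial.hasseDeriv j B)) := by
    intro F _ _
    have hy₁' : (y₁ : F) ≠ 0 := by exact_mod_cast hy₁
    have hy₂' : (y₂ : F) ≠ 0 := by exact_mod_cast hy₂
    rw [hN]
    push_cast
    rw [hz_cast _ D x₁ y₁ ((Polynomial.natDegree_hasseDeriv_le _ _).trans (by omega)) hy₁',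
      hz_cast _ D x₁ y₁ ((Polynomial.natDegree_hasseDeriv_le _ _).trans (by omega)) hy₁']
    field_simp
  have hN0 : N ≠ 0 := by
    intro h0
    have h1 := hNcast ℚ
    rw [h0, Int.cast_zero] at h1
    have hy₁' : (y₁ : ℚ) ≠ 0 := by exact_mod_cast hy₁
    have hy₂' : (y₂ : ℚ) ≠ 0 := by exact_mod_cast hy₂
    exact mul_ne_zero (mul_ne_zero (pow_ne_zero _ hy₁') hy₂') hjne h1.symm
  set w := 2 * q * r - j with hw
  set μ : ι → ℝ := fun v => max (δ₁ v ^ w) (δ₂ v) with hμ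
  have hμ0 : ∀ v, 0 ≤ μ v := fun v => (hδ₂ v).1.trans (le_max_right _ _)
  have hNv : ∀ v, ‖(N : L v)‖ ≤ C ^ r * max ‖(x₁ : L v)‖ ‖(y₁ : L v)‖ ^ D *
      max ‖(x₂ : L v)‖ ‖(y₂ : L v)‖ * μ v := by
    intro v
    have hy₁' : (y₁ : L v) ≠ 0 := by exact_mod_cast hy₁
    have hy₂' : (y₂ : L v) ≠ 0 := by exact_mod_cast hy₂
    rw [hNcast (L v)]
    refine (main_bound A B D (2 * q * r) j hAd hBd (E ^ r) R hR hAE hBE (α v) (hαR v)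
      (hroot (L v) (α v) (hα v)) x₁ y₁ x₂ y₂ hy₁' hy₂' _ _ (δ₁ v) (δ₂ v) (le_max_right _ _)
      (le_max_right _ _) (hδ₁ v).1 (hδ₁ v).2.1 (hδ₂ v).1 (hδ₁ v).2.2.1 (hδ₂ v).2.2.1 (μ v)
      (le_max_left _ _) (le_max_right _ _)).trans (le_of_eq ?_)
    have hCr : C ^ r = (48 * R ^ 3) ^ D * E ^ r := by
      have : D = n * (q + 1) * r := by rw [hD]; ring
      rw [hC, mul_pow ((48 * R ^ 3) ^ (n * (q + 1))) E r, this, ← pow_mul]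
    rw [hCr]
  have hone : 1 ≤ C ^ (r * T) * H₁ ^ D * H₂ * ∏ v, μ v := by
    refine (hprod N hN0).trans ((Finset.prod_le_prod (fun v _ => norm_nonneg _)
      (fun v _ => hNv v)).trans (le_of_eq ?_))
    rw [Finset.prod_mul_distrib, Finset.prod_mul_distrib, Finset.prod_mul_distrib,
      Finset.prod_const, Finset.prod_pow, Finset.card_univ, ← hH₁d, ← hH₂d, ← hT, pow_mul C r T]
  have hμM : ∀ v, H₁ ^ (e v * w) * μ v ^ M ≤ 1 := by
    intro v
    have a1 : H₁ ^ (e v * w) * (δ₁ v ^ w) ^ M ≤ 1 := by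
      have := pow_le_one₀ (n := w) (mul_nonneg (pow_nonneg (by linarith) _)
        (pow_nonneg (hδ₁ v).1 _)) (hδ₁ v).2.2.2
      rw [mul_pow, ← pow_mul, ← pow_mul] at this
      rwa [← pow_mul, mul_comm w M]
    have a2 : H₁ ^ (e v * w) * (δ₂ v) ^ M ≤ 1 := by
      refine le_trans ?_ (hδ₂ v).2.2.2
      refine mul_le_mul_of_nonneg_right ?_ (pow_nonneg (hδ₂ v).1 _)
      rw [mul_comm, pow_mul]
      refine pow_le_pow_left₀ (by positivity) (le_trans ?_ hr1) _
      rw [← pow_mul]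
      exact pow_le_pow_right₀ hH₁1 (Nat.sub_le _ _)
    simp only [hμ]
    rcases max_choice (δ₁ v ^ w) (δ₂ v) with h | h <;> rw [h] <;> assumption
  have hμP : H₁ ^ (w * ∑ v, e v) * (∏ v, μ v) ^ M ≤ 1 := by
    have : H₁ ^ (w * ∑ v, e v) * (∏ v, μ v) ^ M = ∏ v, (H₁ ^ (e v * w) * μ v ^ M) := by
      rw [Finset.prod_mul_distrib, Finset.prod_pow_eq_pow_sum, Finset.prod_pow, ← Finset.sum_mul,
        mul_comm]
      ring
    rw [this]
    exact Finset.prod_le_one (fun v _ => mul_nonneg (by positivity) (pow_nonneg (hμ0 v) _))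
      (fun v _ => hμM v)
  have hPμ0 : 0 ≤ ∏ v, μ v := Finset.prod_nonneg fun v _ => hμ0 v
  have h1 : H₁ ^ (w * ∑ v, e v) ≤ (C ^ (r * T) * H₁ ^ D * H₂) ^ M := by
    have hX : 0 ≤ (C ^ (r * T) * H₁ ^ D * H₂) ^ M := by positivity
    calc H₁ ^ (w * ∑ v, e v) ≤ H₁ ^ (w * ∑ v, e v) * (C ^ (r * T) * H₁ ^ D * H₂ * ∏ v, μ v) ^ M :=
          le_mul_of_one_le_right (by positivity) (one_le_pow₀ hone)
      _ = (C ^ (r * T) * H₁ ^ D * H₂) ^ M * (H₁ ^ (w * ∑ v, e v) * (∏ v, μ v) ^ M) := by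
          rw [mul_pow _ (∏ v, μ v)]; ring
      _ ≤ (C ^ (r * T) * H₁ ^ D * H₂) ^ M * 1 := by gcongr
      _ = _ := mul_one _
  have h2 : 2 ^ (r * M) * H₁ ^ (w * ∑ v, e v) ≤
      H₁ ^ (r * M + n * r * (q + 1) * M + (2 * q * (r + 1)) * M) := by
    calc 2 ^ (r * M) * H₁ ^ (w * ∑ v, e v)
        ≤ 2 ^ (r * M) * (C ^ (r * T) * H₁ ^ D * (H₁ ^ (2 * q)) ^ (r + 1)) ^ M := by
          refine mul_le_mul_of_nonneg_left (h1.trans ?_) (by positivity)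
          gcongr
      _ = (2 * C ^ T) ^ (r * M) * (H₁ ^ (D * M) * H₁ ^ (2 * q * (r + 1) * M)) := by
          rw [mul_pow, mul_pow, mul_pow]
          simp only [← pow_mul]
          rw [show r * T * M = T * (r * M) by ring]
          ring
      _ ≤ H₁ ^ (r * M) * (H₁ ^ (D * M) * H₁ ^ (2 * q * (r + 1) * M)) := by
          gcongr
      _ = _ := by rw [← pow_add, ← pow_add, hD]; congr 1; ring
  have h3 : r * M + n * r * (q + 1) * M + (2 * q * (r + 1)) * M ≤ w * (∑ v, e v) + K₀ := by
    have hw' : (2 * q * r : ℤ) - (2 * n * r + n) ≤ w := by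
      have hj2 : j ≤ 2 * n * r + n := by
        rw [hscard] at hj
        have hm1 : 2 * q * r - 1 + 1 = 2 * q * r := Nat.sub_add_cancel (by
          have : 1 ≤ q * r := Nat.mul_pos (by omega) (by omega)
          nlinarith)
        have : n * (2 * q * r - 1) + n = n * (2 * q * r) := by
          calc n * (2 * q * r - 1) + n = n * (2 * q * r - 1 + 1) := by ring
            _ = _ := by rw [hm1]
        have h5 : 2 * D = n * (2 * q * r) + 2 * n * r := by rw [hD]; ring
        omega
      have : (2 * q * r : ℕ) ≤ w + j := by omega
      zify at this hj2
      linarith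
    have := arith_aux n q (T + 1) M r w (∑ v, e v : ℕ) (by exact_mod_cast hn)
      (by exact_mod_cast hq) (by omega) (by exact_mod_cast hM) (by positivity)
      (by exact_mod_cast he) hw' (by positivity)
    rw [hK₀]
    exact_mod_cast this
  have h4 : 2 ^ (r * M) * H₁ ^ (w * ∑ v, e v) ≤ H₁ ^ (w * ∑ v, e v) * H₁ ^ K₀ := by
    rw [← pow_add]
    exact h2.trans (pow_le_pow_right₀ hH₁1 h3)
  have h5 : (2:ℝ) ^ (r * M) ≤ H₁ ^ K₀ := by
    rw [mul_comm] at h4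
    exact le_of_mul_le_mul_left h4 (by positivity)
  have h6 : (2:ℝ) ^ r₀ ≤ 2 ^ (r * M) := by
    refine pow_le_pow_right₀ (by norm_num) ?_
    have : 1 ≤ M := by rw [hM]; exact Nat.mul_pos (by omega) (by omega)
    nlinarith
  linarith

lemma one_le_prod_real {ι : Type} [Fintype ι] {g : ι → ℝ} (hg : ∀ v, 1 ≤ g v) : 1 ≤ ∏ v, g v := by
  have := Finset.prod_le_prod (s := Finset.univ) (f := fun _ : ι => (1:ℝ)) (g := g)
    (fun _ _ => zero_le_one) (fun v _ => hg v)
  simpa using this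

lemma sep_map (f : Polynomial ℤ) (hsep : (f.map (Int.castRingHom ℚ)).Separable)
    (F : Type) [Field F] [CharZero F] : (f.map (Int.castRingHom F)).Separable := by
  have h := hsep.map (f := algebraMap ℚ F)
  rw [Polynomial.map_map] at h
  rwa [RingHom.ext_int ((algebraMap ℚ F).comp (Int.castRingHom ℚ)) (Int.castRingHom F)] at h

lemma roots_finite (f : Polynomial ℤ) (hf : f ≠ 0) (F : Type) [Field F] [CharZero F] :
    {α : F | Polynomial.aeval α f = 0}.Finite := by
  classical
  refine ((f.map (Int.castRingHom F)).roots.toFinset.finite_toSet).subset ?_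
  intro α hα
  have h0 : f.map (Int.castRingHom F) ≠ 0 :=
    (Polynomial.map_ne_zero_iff (RingHom.injective_int _)).2 hf
  simp only [Set.mem_setOf_eq] at hα
  simp only [Finset.mem_coe, Multiset.mem_toFinset]
  rw [Polynomial.mem_roots h0, Polynomial.IsRoot.def, Polynomial.eval_map]
  simpa [Polynomial.aeval_def] using hα

lemma complex_roots (f : Polynomial ℤ) (hf : f ≠ 0)
    (hsep : (f.map (Int.castRingHom ℚ)).Separable) :
    ∃ s : Finset ℂ, (∀ z, z ∈ s ↔ Polynomial.aeval z f = 0) ∧ s.card = f.natDegree := by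
  classical
  have h0 : f.map (Int.castRingHom ℂ) ≠ 0 :=
    (Polynomial.map_ne_zero_iff (RingHom.injective_int _)).2 hf
  refine ⟨(f.map (Int.castRingHom ℂ)).roots.toFinset, ?_, ?_⟩
  · intro z
    rw [Multiset.mem_toFinset, Polynomial.mem_roots h0, Polynomial.IsRoot.def, Polynomial.eval_map]
    simp [Polynomial.aeval_def]
  · rw [Multiset.toFinset_card_of_nodup (Polynomial.nodup_roots (sep_map f hsep ℂ)),
      ← (IsAlgClosed.splits (f.map (Int.castRingHom ℂ))).natDegree_eq_card_roots,
      Polynomial.natDegree_map_eq_of_injective (RingHom.injective_int _)]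

lemma abs_bound {ι : Type} [Fintype ι] (L : ι → Type) [∀ v, NormedField (L v)]
    [∀ v, CharZero (L v)] [∀ v, IsAlgClosed (L v)]
    (hprod : ∀ N : ℤ, N ≠ 0 → 1 ≤ ∏ v, ‖(N : L v)‖)
    (f : Polynomial ℤ) (hn : 3 ≤ f.natDegree)
    (hsep : (f.map (Int.castRingHom ℚ)).Separable) (K : ℝ) :
    ∃ Bd : ℝ, ∀ x y : ℤ, y ≠ 0 → Polynomial.aeval ((x : ℚ) / y) f ≠ 0 →
      (∀ v, 1 ≤ max ‖(x : L v)‖ ‖(y : L v)‖) →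
      ∏ v, ‖(y : L v) ^ f.natDegree * Polynomial.aeval ((x : L v) / y) f‖ ≤ K →
      ∏ v, max ‖(x : L v)‖ ‖(y : L v)‖ ≤ Bd := by
  classical
  have hf0 : f ≠ 0 := by rintro rfl; simp at hn
  obtain ⟨s, hs, hscard⟩ := complex_roots f hf0 hsep
  choose C hC1 hC using fun v => local_root (L := L v) f (by omega) (sep_map f hsep (L v))
  have hRv : ∀ v, ∃ B : ℝ, ∀ α : L v, Polynomial.aeval α f = 0 → ‖α‖ ≤ B := by
    intro v
    obtain ⟨B, hB⟩ := ((roots_finite f hf0 (L v)).image (fun α => ‖α‖)).bddAbove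
    exact ⟨B, fun α hα => hB ⟨α, hα, rfl⟩⟩
  choose Rv hRv using hRv
  obtain ⟨R, hR1, hR⟩ : ∃ R : ℝ, 1 ≤ R ∧ ∀ v, ∀ α : L v, Polynomial.aeval α f = 0 →
      1 + ‖α‖ ≤ R := by
    refine ⟨1 + ∑ v, |Rv v|, ?_, ?_⟩
    · have : 0 ≤ ∑ v, |Rv v| := Finset.sum_nonneg fun v _ => abs_nonneg _
      linarith
    · intro v α hα
      have h1 := hRv v α hα
      have h2 := le_abs_self (Rv v)
      have h3 : |Rv v| ≤ ∑ v, |Rv v| :=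
        Finset.single_le_sum (f := fun v => |Rv v|) (fun v _ => abs_nonneg _) (Finset.mem_univ v)
      linarith
  set n := f.natDegree with hnd
  obtain ⟨q, hq⟩ : ∃ q, q = 2 * n ^ 2 + n + 2 := ⟨_, rfl⟩
  obtain ⟨M, hM⟩ : ∃ M, M = 2 * q * (Fintype.card ι + 1) := ⟨_, rfl⟩
  haveI : ∀ v, Finite {α : L v // Polynomial.aeval α f = 0} := fun v => roots_finite f hf0 (L v)
  have hcore : ∀ θ : (∀ v, {α : L v // Polynomial.aeval α f = 0}) × (ι → Fin (n * M + 1)),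
      ∃ Bd : ℝ, n * M ≤ ∑ v, (θ.2 v : ℕ) + (Fintype.card ι + 1) →
        ∀ x y : ℤ, GoodPair L f (fun v => (θ.1 v).1) R M (fun v => (θ.2 v : ℕ)) x y →
          ∏ v, max ‖(x : L v)‖ ‖(y : L v)‖ ≤ Bd := by
    intro θ
    by_cases hc : n * M ≤ ∑ v, (θ.2 v : ℕ) + (Fintype.card ι + 1)
    · obtain ⟨Bd, hBd⟩ := core_bound L hprod f hn s hs hscard (fun v => (θ.1 v).1)
        (fun v => (θ.1 v).2) R hR1 (fun v => by linarith [hR v _ (θ.1 v).2]) q M hq hM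
        (fun v => (θ.2 v : ℕ)) hc
      exact ⟨Bd, fun _ => hBd⟩
    · exact ⟨0, fun h => absurd h hc⟩
  choose Bd hBd using hcore
  haveI : Fintype ((∀ v, {α : L v // Polynomial.aeval α f = 0}) × (ι → Fin (n * M + 1))) :=
    Fintype.ofFinite _
  obtain ⟨C', hC'⟩ : ∃ C', C' = max 1 ((∏ v, C v) * K) := ⟨_, rfl⟩
  refine ⟨max (C' ^ M) (∑ θ, |Bd θ|), fun x y hy hfx hh hK => ?_⟩
  have hyL : ∀ v, (y : L v) ≠ 0 := fun v => by exact_mod_cast hy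
  choose α hα hαb using fun v => hC v (x : L v) (y : L v) (hyL v)
  set h : ι → ℝ := fun v => max ‖(x : L v)‖ ‖(y : L v)‖ with hhd
  change ∀ v, 1 ≤ h v at hh
  have hh0 : ∀ v, 0 < h v := fun v => lt_of_lt_of_le one_pos (hh v)
  set H := ∏ v, h v with hH
  have hH1 : 1 ≤ H := one_le_prod_real hh
  obtain ⟨δ, hδ⟩ : ∃ δ : ι → ℝ, ∀ v, δ v = min 1 (‖(x : L v) - α v * y‖ / h v) := ⟨_, fun _ => rfl⟩
  have hδ0 : ∀ v, 0 ≤ δ v := fun v => by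
    rw [hδ]; exact le_min zero_le_one (div_nonneg (norm_nonneg _) (hh0 v).le)
  have hδ1 : ∀ v, δ v ≤ 1 := fun v => by rw [hδ]; exact min_le_left _ _
  have hC0 : ∀ v, 0 ≤ C v := fun v => zero_le_one.trans (hC1 v)
  have hprodδ : (∏ v, δ v) * H ^ n ≤ C' := by
    rw [hH, ← Finset.prod_pow, ← Finset.prod_mul_distrib]
    calc ∏ v, (δ v * h v ^ n) ≤ ∏ v, (C v *
          ‖(y : L v) ^ n * Polynomial.aeval ((x : L v) / y) f‖) := by
          refine Finset.prod_le_prod (fun v _ => mul_nonneg (hδ0 v) (pow_nonneg (hh0 v).le _))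
            (fun v _ => le_trans ?_ (hαb v))
          have : δ v ≤ ‖(x : L v) - α v * y‖ / h v := by rw [hδ]; exact min_le_right _ _
          calc δ v * h v ^ n ≤ ‖(x : L v) - α v * y‖ / h v * h v ^ n :=
                mul_le_mul_of_nonneg_right this (pow_nonneg (hh0 v).le _)
            _ = ‖(x : L v) - α v * y‖ * h v ^ (n - 1) := by
                obtain ⟨m, hm⟩ : ∃ m, n = m + 1 := ⟨n - 1, by omega⟩
                rw [hm, Nat.add_sub_cancel, pow_succ]
                field_simp [(hh0 v).ne']
      _ = (∏ v, C v) * ∏ v, ‖(y : L v) ^ n * Polynomial.aeval ((x : L v) / y) f‖ :=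
          Finset.prod_mul_distrib
      _ ≤ (∏ v, C v) * K := mul_le_mul_of_nonneg_left hK (Finset.prod_nonneg fun v _ => hC0 v)
      _ ≤ C' := by rw [hC']; exact le_max_right _ _
  by_cases hHC : H ≤ C' ^ M
  · exact hHC.trans (le_max_left _ _)
  push Not at hHC
  set e : ι → ℕ := fun v => Nat.findGreatest (fun e => H ^ e * δ v ^ M ≤ 1) (n * M) with he
  have heP : ∀ v, H ^ (e v) * δ v ^ M ≤ 1 := by
    intro v
    refine Nat.findGreatest_spec (P := fun e => H ^ e * δ v ^ M ≤ 1) (m := 0) (Nat.zero_le _) ?_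
    simpa using pow_le_one₀ (hδ0 v) (hδ1 v)
  have hele : ∀ v, e v ≤ n * M := fun v => Nat.findGreatest_le _
  have hsum : n * M ≤ ∑ v, e v + (Fintype.card ι + 1) := by
    by_contra hlt
    push Not at hlt
    have hgt : ∀ v, 1 ≤ H ^ (e v + 1) * δ v ^ M := by
      intro v
      have h1 : e v ≤ ∑ v, e v := Finset.single_le_sum (fun v _ => Nat.zero_le _) (Finset.mem_univ v)
      have := Nat.findGreatest_is_greatest (P := fun e => H ^ e * δ v ^ M ≤ 1) (n := n * M)
        (k := e v + 1) (Nat.lt_succ_self _) (by omega)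
      exact (not_le.1 this).le
    have hP : 1 ≤ H ^ (∑ v, e v + Fintype.card ι) * (∏ v, δ v) ^ M := by
      have := one_le_prod_real hgt
      rwa [Finset.prod_mul_distrib, Finset.prod_pow_eq_pow_sum, Finset.prod_pow,
        Finset.sum_add_distrib, Finset.sum_const, Finset.card_univ, smul_eq_mul, mul_one] at this
    have hδp : 0 ≤ (∏ v, δ v) ^ M := pow_nonneg (Finset.prod_nonneg fun v _ => hδ0 v) _
    have hfin : H ≤ C' ^ M := by
      calc H = H * 1 := (mul_one _).symm
        _ ≤ H * (H ^ (∑ v, e v + Fintype.card ι) * (∏ v, δ v) ^ M) :=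
            mul_le_mul_of_nonneg_left hP (by linarith)
        _ = H ^ (∑ v, e v + Fintype.card ι + 1) * (∏ v, δ v) ^ M := by ring
        _ ≤ H ^ (n * M) * (∏ v, δ v) ^ M :=
            mul_le_mul_of_nonneg_right (pow_le_pow_right₀ hH1 (by omega)) hδp
        _ = ((∏ v, δ v) * H ^ n) ^ M := by rw [mul_pow, pow_mul]; ring
        _ ≤ C' ^ M := pow_le_pow_left₀ (mul_nonneg (Finset.prod_nonneg fun v _ => hδ0 v)
            (pow_nonneg (by linarith) _)) hprodδ _
    linarith
  refine le_trans ?_ (le_max_right _ _)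
  obtain ⟨θ, hθ⟩ : ∃ θ : (∀ v, {α : L v // Polynomial.aeval α f = 0}) × (ι → Fin (n * M + 1)),
      θ = (fun v => ⟨α v, hα v⟩, fun v => ⟨e v, Nat.lt_succ_of_le (hele v)⟩) := ⟨_, rfl⟩
  have hθ1 : ∀ v, (θ.1 v).1 = α v := fun v => by rw [hθ]
  have hθ2 : ∀ v, (θ.2 v : ℕ) = e v := fun v => by rw [hθ]
  have hfinal : H ≤ Bd θ := by
    refine hBd θ (by simpa only [hθ2] using hsum) x y ⟨hy, hfx, hh, δ, fun v => ?_⟩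
    simp only [hθ1, hθ2]
    refine ⟨hδ0 v, hδ1 v, ?_, heP v⟩
    change _ ≤ R * δ v * h v
    rcases le_total 1 (‖(x : L v) - α v * y‖ / h v) with hc | hc
    · rw [hδ, min_eq_left hc, mul_one]
      have h1 : ‖(x : L v)‖ ≤ h v := le_max_left _ _
      have h2 : ‖(y : L v)‖ ≤ h v := le_max_right _ _
      calc ‖(x : L v) - α v * y‖ ≤ ‖(x : L v)‖ + ‖α v * y‖ := norm_sub_le _ _
        _ = ‖(x : L v)‖ + ‖α v‖ * ‖(y : L v)‖ := by rw [norm_mul]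
        _ ≤ h v + ‖α v‖ * h v := add_le_add h1 (mul_le_mul_of_nonneg_left h2 (norm_nonneg _))
        _ = (1 + ‖α v‖) * h v := by ring
        _ ≤ R * h v := mul_le_mul_of_nonneg_right (hR v _ (hα v)) (hh0 v).le
    · rw [hδ, min_eq_right hc, mul_assoc, div_mul_cancel₀ _ (hh0 v).ne']
      exact le_mul_of_one_le_left (norm_nonneg _) hR1
  exact hfinal.trans ((le_abs_self _).trans (Finset.single_le_sum (f := fun θ => |Bd θ|)
    (fun _ _ => abs_nonneg _) (Finset.mem_univ θ)))

/-- the places at infinity and above the given primes -/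
def PlL {t : ℕ} (p : Fin t → ℕ) [∀ i, Fact (p i).Prime] : Option (Fin t) → Type
  | none => ℂ
  | some i => PadicAlgCl (p i)

noncomputable instance {t : ℕ} (p : Fin t → ℕ) [∀ i, Fact (p i).Prime] :
    ∀ v, NormedField (PlL p v)
  | none => inferInstanceAs (NormedField ℂ)
  | some i => inferInstanceAs (NormedField (PadicAlgCl (p i)))

instance {t : ℕ} (p : Fin t → ℕ) [∀ i, Fact (p i).Prime] : ∀ v, CharZero (PlL p v)
  | none => inferInstanceAs (CharZero ℂ)
  | some i => inferInstanceAs (CharZero (PadicAlgCl (p i)))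

instance {t : ℕ} (p : Fin t → ℕ) [∀ i, Fact (p i).Prime] : ∀ v, IsAlgClosed (PlL p v)
  | none => inferInstanceAs (IsAlgClosed ℂ)
  | some i => inferInstanceAs (IsAlgClosed (PadicAlgCl (p i)))

lemma PlL_none {t : ℕ} (p : Fin t → ℕ) [∀ i, Fact (p i).Prime] (N : ℤ) :
    ‖(N : PlL p none)‖ = |(N : ℝ)| := by
  change ‖(N : ℂ)‖ = _
  simp

lemma PlL_some {t : ℕ} (p : Fin t → ℕ) [∀ i, Fact (p i).Prime] (i : Fin t) (N : ℤ) :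
    ‖(N : PlL p (some i))‖ = ‖(N : ℚ_[p i])‖ := by
  change ‖(N : PadicAlgCl (p i))‖ = _
  rw [← PadicAlgCl.norm_extends]
  congr 1

lemma PlL_prod {t : ℕ} (p : Fin t → ℕ) [∀ i, Fact (p i).Prime] (N : ℤ) :
    ∏ v, ‖(N : PlL p v)‖ = |(N : ℝ)| * ∏ i, ‖(N : ℚ_[p i])‖ := by
  rw [Fintype.prod_option, PlL_none]
  congr 1
  exact Finset.prod_congr rfl fun i _ => PlL_some p i N

lemma PlL_ge {t : ℕ} (p : Fin t → ℕ) [hp : ∀ i, Fact (p i).Prime] (hinj : Function.Injective p)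
    (N : ℤ) (hN : N ≠ 0) : 1 ≤ ∏ v, ‖(N : PlL p v)‖ := by
  rw [PlL_prod]
  have h1 : ∀ i, ‖(N : ℚ_[p i])‖ = ((p i : ℝ) ^ (padicValInt (p i) N))⁻¹ := by
    intro i
    have := Padic.eq_padicNorm (p := p i) (N : ℚ)
    rw [Rat.cast_intCast] at this
    rw [this, padicNorm.eq_zpow_of_nonzero (by exact_mod_cast hN), padicValRat.of_int]
    push_cast
    rw [zpow_neg, zpow_natCast]
  simp_rw [h1]
  have hd : (∏ i, (p i : ℤ) ^ (padicValInt (p i) N)) ∣ N := by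
    refine Finset.prod_dvd_of_coprime ?_ (fun i _ => padicValInt_dvd N)
    intro i _ j _ hij
    refine IsCoprime.pow ?_
    rw [Nat.isCoprime_iff_coprime]
    exact (Nat.coprime_primes (hp i).out (hp j).out).2 (fun h => hij (hinj h))
  have h2 : (∏ i, (p i : ℤ) ^ (padicValInt (p i) N)) ≤ |N| :=
    Int.le_of_dvd (abs_pos.2 hN) ((dvd_abs _ _).2 hd)
  have h3 : (∏ i, (p i : ℝ) ^ (padicValInt (p i) N)) ≤ |(N : ℝ)| := by exact_mod_cast h2
  have h4 : 0 < (∏ i, (p i : ℝ) ^ (padicValInt (p i) N)) :=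
    Finset.prod_pos fun i _ => pow_pos (by exact_mod_cast (hp i).out.pos) _
  rw [Finset.prod_inv_distrib, ← div_eq_mul_inv, one_le_div h4]
  exact h3

lemma PlL_prime {t : ℕ} (p : Fin t → ℕ) [hp : ∀ i, Fact (p i).Prime] (i : Fin t) :
    ∏ v, ‖(((p i : ℤ) : PlL p v))‖ ≤ 1 := by
  rw [PlL_prod]
  have hpos : (0:ℝ) < p i := by exact_mod_cast (hp i).out.pos
  have : ∏ j, ‖(((p i : ℤ) : ℚ_[p j]))‖ ≤ ∏ j, (if j = i then ((p i : ℝ))⁻¹ else 1) := by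
    refine Finset.prod_le_prod (fun _ _ => norm_nonneg _) (fun j _ => ?_)
    split_ifs with h
    · subst h
      simp
    · exact Padic.norm_int_le_one _
  rw [Finset.prod_ite_eq' Finset.univ i] at this
  simp only [Finset.mem_univ, if_true] at this
  calc |(((p i : ℤ)) : ℝ)| * _ ≤ |(((p i : ℤ)) : ℝ)| * ((p i : ℝ))⁻¹ :=
        mul_le_mul_of_nonneg_left this (abs_nonneg _)
    _ = 1 := by
        rw [Int.cast_natCast, abs_of_pos hpos, mul_inv_cancel₀ hpos.ne']

lemma PlL_le {t : ℕ} (p : Fin t → ℕ) [hp : ∀ i, Fact (p i).Prime] (hinj : Function.Injective p)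
    (W K : ℤ) (hK : K ≠ 0) (z : Fin t → ℕ) (hd : W ∣ K * ∏ i, (p i : ℤ) ^ z i) :
    ∏ v, ‖(W : PlL p v)‖ ≤ |(K : ℝ)| := by
  obtain ⟨m, hm⟩ := hd
  have hne : K * ∏ i, (p i : ℤ) ^ z i ≠ 0 := mul_ne_zero hK (Finset.prod_ne_zero_iff.2 fun i _ =>
    pow_ne_zero _ (by exact_mod_cast (hp i).out.ne_zero))
  have hm0 : m ≠ 0 := by rintro rfl; exact hne (by rw [hm, mul_zero])
  have e1 : ∏ v, ‖((K * ∏ i, (p i : ℤ) ^ z i : ℤ) : PlL p v)‖ =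
      (∏ v, ‖(K : PlL p v)‖) * ∏ i, (∏ v, ‖((p i : ℤ) : PlL p v)‖) ^ z i := by
    simp_rw [← Finset.prod_pow]
    rw [Finset.prod_comm, ← Finset.prod_mul_distrib]
    refine Finset.prod_congr rfl fun v _ => ?_
    rw [Int.cast_mul, norm_mul, Int.cast_prod, norm_prod]
    simp only [Int.cast_pow, norm_pow]
  have e2 : ∏ v, ‖((W * m : ℤ) : PlL p v)‖ = (∏ v, ‖(W : PlL p v)‖) * ∏ v, ‖(m : PlL p v)‖ := by
    rw [← Finset.prod_mul_distrib]
    refine Finset.prod_congr rfl fun v _ => ?_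
    rw [Int.cast_mul, norm_mul]
  have h1 : ∏ i, (∏ v, ‖((p i : ℤ) : PlL p v)‖) ^ z i ≤ 1 :=
    Finset.prod_le_one (fun i _ => pow_nonneg (Finset.prod_nonneg fun _ _ => norm_nonneg _) _)
      (fun i _ => pow_le_one₀ (Finset.prod_nonneg fun _ _ => norm_nonneg _) (PlL_prime p i))
  have h2 : ∏ v, ‖(K : PlL p v)‖ ≤ |(K : ℝ)| := by
    rw [PlL_prod]
    exact mul_le_of_le_one_right (abs_nonneg _) (Finset.prod_le_one (fun _ _ => norm_nonneg _)
      (fun i _ => Padic.norm_int_le_one _))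
  have h3 := PlL_ge p hinj m hm0
  have hK0 : 0 ≤ ∏ v, ‖(K : PlL p v)‖ := Finset.prod_nonneg fun _ _ => norm_nonneg _
  have hW0 : 0 ≤ ∏ v, ‖(W : PlL p v)‖ := Finset.prod_nonneg fun _ _ => norm_nonneg _
  calc ∏ v, ‖(W : PlL p v)‖ ≤ (∏ v, ‖(W : PlL p v)‖) * ∏ v, ‖(m : PlL p v)‖ :=
        le_mul_of_one_le_right hW0 h3
    _ = (∏ v, ‖(K : PlL p v)‖) * ∏ i, (∏ v, ‖((p i : ℤ) : PlL p v)‖) ^ z i := by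
        rw [← e2, ← hm, e1]
    _ ≤ ∏ v, ‖(K : PlL p v)‖ := mul_le_of_le_one_right hK0 h1
    _ ≤ _ := h2

lemma thue_finite {t : ℕ} (p : Fin t → ℕ) [hp : ∀ i, Fact (p i).Prime]
    (hinj : Function.Injective p) (f : Polynomial ℤ) (hn : 3 ≤ f.natDegree)
    (hsep : (f.map (Int.castRingHom ℚ)).Separable) (K : ℤ) (hK : K ≠ 0) :
    {s : ℤ × ℤ | s.2 ≠ 0 ∧ hz f f.natDegree s.1 s.2 ≠ 0 ∧ (∀ i, ¬ (p i : ℤ) ∣ s.1) ∧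
      ∃ z : Fin t → ℕ, hz f f.natDegree s.1 s.2 ∣ K * ∏ i, (p i : ℤ) ^ z i}.Finite := by
  obtain ⟨Bd, hBd⟩ := abs_bound (PlL p) (PlL_ge p hinj) f hn hsep |(K : ℝ)|
  obtain ⟨B, hB⟩ := exists_nat_ge Bd
  refine ((Set.finite_Icc (-(B:ℤ)) B).prod (Set.finite_Icc (-(B:ℤ)) B)).subset ?_
  rintro ⟨x, y⟩ ⟨hy, hW, hx, z, hd⟩
  dsimp only at hy hW hx hd
  have hh : ∀ v, 1 ≤ max ‖(x : PlL p v)‖ ‖(y : PlL p v)‖ := by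
    rintro (_ | i)
    · refine le_trans ?_ (le_max_right _ _)
      rw [PlL_none]
      have : 1 ≤ |y| := Int.one_le_abs hy
      exact_mod_cast this
    · refine le_trans ?_ (le_max_left _ _)
      rw [PlL_some]
      by_contra hlt
      push Not at hlt
      exact hx i (Padic.norm_intCast_lt_one_iff.1 hlt)
  have hyF : ∀ (F : Type) [Field F] [CharZero F], (y : F) ≠ 0 := fun F _ _ => by exact_mod_cast hy
  have hle := hBd x y hy (by
    intro h0
    apply hW
    have := hz_cast f f.natDegree x y le_rfl (hyF ℚ)
    rw [h0, mul_zero] at this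
    exact_mod_cast this) hh (by
    refine le_trans (le_of_eq ?_) (PlL_le p hinj _ K hK z hd)
    refine Finset.prod_congr rfl fun v _ => ?_
    rw [hz_cast f f.natDegree x y le_rfl (hyF (PlL p v))])
  have h1 : max |(x : ℝ)| |(y : ℝ)| ≤ B := by
    refine le_trans ?_ (hle.trans hB)
    rw [Fintype.prod_option, PlL_none, PlL_none]
    refine le_mul_of_one_le_right (le_max_of_le_left (abs_nonneg _)) ?_
    exact one_le_prod_real fun i => hh (some i)
  have hx' : |x| ≤ B := by exact_mod_cast (le_max_left _ _).trans h1
  have hy' : |y| ≤ B := by exact_mod_cast (le_max_right _ _).trans h1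
  exact ⟨abs_le.1 hx', abs_le.1 hy'⟩

lemma homog_smul {A : Type*} [CommRing A] (f : MvPolynomial (Fin 2) ℤ) (n : ℕ)
    (hf : f.IsHomogeneous n) (c : A) (u : Fin 2 → A) :
    MvPolynomial.aeval (fun i => c * u i) f = c ^ n * MvPolynomial.aeval u f := by
  rw [MvPolynomial.aeval_def, MvPolynomial.aeval_def, MvPolynomial.eval₂_eq',
    MvPolynomial.eval₂_eq', Finset.mul_sum]
  refine Finset.sum_congr rfl fun d hd => ?_
  have h := hf.degree_eq_sum_deg_support hd
  have h' : d 0 + d 1 = n := by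
    rw [h, Finset.sum_subset (Finset.subset_univ d.support) (fun i _ hi => by simpa using hi),
      Fin.sum_univ_two]
  rw [Fin.prod_univ_two, Fin.prod_univ_two, ← h', mul_pow, mul_pow, pow_add]
  ring

lemma exists_int_poly (r : Polynomial ℚ) :
    ∃ (b : ℤ) (h : Polynomial ℤ), b ≠ 0 ∧ h.map (Int.castRingHom ℚ) = Polynomial.C (b : ℚ) * r := by
  obtain ⟨b, hb⟩ := IsLocalization.integerNormalization_spec (nonZeroDivisors ℤ) r
  refine ⟨b, _, nonZeroDivisors.ne_zero hb.1, hb.2.trans ?_⟩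
  rw [← Polynomial.smul_eq_C_mul, Int.cast_smul_eq_zsmul]

lemma sqfree_part (φ : Polynomial ℤ) (hφ : φ ≠ 0) (s : Finset ℂ) (hs : 3 ≤ s.card)
    (hroot : ∀ z ∈ s, Polynomial.aeval z φ = 0) :
    ∃ (h g : Polynomial ℤ) (M : ℤ), M ≠ 0 ∧ Polynomial.C M * φ = h * g ∧ 3 ≤ h.natDegree ∧
      (h.map (Int.castRingHom ℚ)).Separable := by
  set ψ := φ.map (Int.castRingHom ℚ) with hψ
  have hψ0 : ψ ≠ 0 := (Polynomial.map_ne_zero_iff (RingHom.injective_int _)).2 hφ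
  obtain ⟨m, hm⟩ := UniqueFactorizationMonoid.exists_dvd_radical_self_pow hψ0
  obtain ⟨g', hg'⟩ := UniqueFactorizationMonoid.radical_dvd_self (a := ψ)
  have hsq : Squarefree (UniqueFactorizationMonoid.radical ψ) :=
    UniqueFactorizationMonoid.squarefree_radical
  have hr0 : UniqueFactorizationMonoid.radical ψ ≠ 0 := UniqueFactorizationMonoid.radical_ne_zero
  set r := UniqueFactorizationMonoid.radical ψ with hr
  clear_value r
  obtain ⟨b, h, hb, hh⟩ := exists_int_poly r
  obtain ⟨c, g, hc, hg⟩ := exists_int_poly g'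
  have hbQ : (b : ℚ) ≠ 0 := by exact_mod_cast hb
  have hdeg : h.natDegree = r.natDegree := by
    rw [← Polynomial.natDegree_map_eq_of_injective (RingHom.injective_int (Int.castRingHom ℚ)) h, hh,
      Polynomial.natDegree_C_mul hbQ]
  refine ⟨h, g, b * c, mul_ne_zero hb hc, ?_, ?_, ?_⟩
  · apply Polynomial.map_injective _ (RingHom.injective_int (Int.castRingHom ℚ))
    rw [Polynomial.map_mul, Polynomial.map_mul, hh, hg, ← hψ, hg', Polynomial.map_C]
    simp only [eq_intCast, Int.cast_mul, Polynomial.C_mul]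
    ring
  · rw [hdeg]
    have hrC : r.map (algebraMap ℚ ℂ) ≠ 0 :=
      (Polynomial.map_ne_zero_iff (algebraMap ℚ ℂ).injective).2 hr0
    have hsub : s.val ≤ (r.map (algebraMap ℚ ℂ)).roots := by
      rw [Multiset.le_iff_subset s.nodup]
      intro z hz
      have hz' := hroot z hz
      rw [Polynomial.mem_roots hrC, Polynomial.IsRoot.def, Polynomial.eval_map_algebraMap]
      obtain ⟨u, hu⟩ := hm
      have h1 : Polynomial.aeval z ψ = 0 := by
        rw [hψ, ← Polynomial.eval_map_algebraMap, Polynomial.map_map]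
        rw [← Polynomial.eval_map_algebraMap] at hz'
        exact hz'
      have h2 := congrArg (Polynomial.aeval z) hu
      rw [map_pow, map_mul, h1, zero_mul] at h2
      by_contra hne
      exact pow_ne_zero m hne h2
    have h3 := Multiset.card_le_card hsub
    have h4 := Polynomial.card_roots' (r.map (algebraMap ℚ ℂ))
    rw [Polynomial.natDegree_map] at h4
    have : s.card = Multiset.card s.val := rfl
    omega
  · rw [hh]
    exact ((PerfectField.separable_iff_squarefree).2 hsq).unit_mul
      ((Polynomial.isUnit_C).2 (isUnit_iff_ne_zero.2 hbQ))

lemma hz_mul (h g φ : Polynomial ℤ) (M : ℤ) (hM : M ≠ 0) (hφ : φ ≠ 0)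
    (hfac : Polynomial.C M * φ = h * g)
    (n : ℕ) (hn : φ.natDegree ≤ n) (x y : ℤ) (hy : y ≠ 0) :
    hz h h.natDegree x y ∣ M * hz φ n x y := by
  have hd : h.natDegree + g.natDegree = φ.natDegree := by
    have h0 : h * g ≠ 0 := by
      rw [← hfac]; exact mul_ne_zero (Polynomial.C_ne_zero.2 hM) hφ
    rw [← Polynomial.natDegree_mul (left_ne_zero_of_mul h0) (right_ne_zero_of_mul h0), ← hfac,
      Polynomial.natDegree_C_mul hM]
  refine ⟨hz g (n - h.natDegree) x y, ?_⟩
  have hyQ : (y : ℚ) ≠ 0 := by exact_mod_cast hy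
  have : ((M * hz φ n x y : ℤ) : ℚ) =
      ((hz h h.natDegree x y * hz g (n - h.natDegree) x y : ℤ) : ℚ) := by
    push_cast
    rw [hz_cast φ n x y hn hyQ, hz_cast h _ x y le_rfl hyQ,
      hz_cast g (n - h.natDegree) x y (by omega) hyQ]
    have e := congrArg (Polynomial.aeval ((x : ℚ) / y)) hfac
    rw [map_mul, map_mul, Polynomial.aeval_C] at e
    simp only [eq_intCast] at e
    have e2 : (y : ℚ) ^ n = (y : ℚ) ^ h.natDegree * (y : ℚ) ^ (n - h.natDegree) := by
      rw [← pow_add]; congr 1; omega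
    rw [e2]
    linear_combination (y : ℚ) ^ h.natDegree * (y : ℚ) ^ (n - h.natDegree) * e
  exact_mod_cast this

lemma aeval_comp_poly {A : Type*} [CommRing A] (f : MvPolynomial (Fin 2) ℤ)
    (P Q : Polynomial ℤ) (z : A) :
    Polynomial.aeval z (MvPolynomial.aeval ![P, Q] f) =
      MvPolynomial.aeval ![Polynomial.aeval z P, Polynomial.aeval z Q] f := by
  rw [← AlgHom.comp_apply, MvPolynomial.comp_aeval]
  congr 2
  funext i
  fin_cases i <;> rfl

lemma aeval_cast {A : Type*} [CommRing A] (f : MvPolynomial (Fin 2) ℤ) (x y : ℤ) :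
    ((MvPolynomial.aeval ![x, y] f : ℤ) : A) = MvPolynomial.aeval ![(x : A), (y : A)] f := by
  have := MvPolynomial.aeval_algebraMap_apply A ![x, y] f
  rw [← eq_intCast (algebraMap ℤ A), ← this]
  congr 2
  funext i
  fin_cases i <;> simp

lemma homog_smul2 {A : Type*} [CommRing A] (f : MvPolynomial (Fin 2) ℤ) (n : ℕ)
    (hf : f.IsHomogeneous n) (c u v : A) :
    MvPolynomial.aeval ![c * u, c * v] f = c ^ n * MvPolynomial.aeval ![u, v] f := by
  rw [← homog_smul f n hf]
  congr 2
  funext i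
  fin_cases i <;> rfl

lemma pairs_finite (f : MvPolynomial (Fin 2) ℤ) (n : ℕ) (hf : f.IsHomogeneous n)
    (a b : Fin 3 → ℂ) (g : MvPolynomial (Fin 2) ℂ)
    (hfact : f.map (Int.castRingHom ℂ) =
      (∏ i, (C (a i) * X 0 + C (b i) * X 1)) * g)
    (hprop : ∀ i j, i ≠ j → a i * b j ≠ a j * b i)
    (k : ℤ) (hk : k ≠ 0) (t : ℕ) (p : Fin t → ℕ)
    [hp : ∀ i, Fact (p i).Prime] (hpinj : Function.Injective p) :
    {s : ℤ × ℤ | s.1 ≠ 0 ∧ (∀ i, ¬ (p i : ℤ) ∣ s.1) ∧ ∃ z : Fin t → ℕ,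
      MvPolynomial.aeval ![s.1, s.2] f = k * ∏ i, (p i : ℤ) ^ z i}.Finite := by
  classical
  have hne : ∀ z : Fin t → ℕ, k * ∏ i, (p i : ℤ) ^ z i ≠ 0 := fun z =>
    mul_ne_zero hk (Finset.prod_ne_zero_iff.2 fun i _ =>
      pow_ne_zero _ (by exact_mod_cast (hp i).out.ne_zero))
  by_cases hc : ∃ c : ℤ, MvPolynomial.aeval ![(1 : ℤ), c] f ≠ 0
  swap
  · push Not at hc
    have hψ : MvPolynomial.aeval ![(1 : Polynomial ℤ), Polynomial.X] f = 0 := by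
      refine Polynomial.funext fun c => ?_
      have := aeval_comp_poly f 1 Polynomial.X c
      rw [map_one, Polynomial.aeval_X, hc c] at this
      rw [Polynomial.eval_zero, ← this, Polynomial.coe_aeval_eq_eval]
    convert Set.finite_empty
    rw [Set.eq_empty_iff_forall_notMem]
    rintro ⟨x, y⟩ ⟨hx, -, z, hz⟩
    dsimp only at hx hz
    apply hne z
    rw [← hz]
    have hxQ : (x : ℚ) ≠ 0 := by exact_mod_cast hx
    have h1 := aeval_comp_poly f 1 Polynomial.X ((y : ℚ) / x)
    rw [hψ, map_zero, map_one, Polynomial.aeval_X] at h1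
    have h2 := homog_smul2 f n hf (x : ℚ) 1 ((y : ℚ) / x)
    rw [← h1, mul_zero, mul_one, mul_div_cancel₀ _ hxQ, ← aeval_cast] at h2
    exact_mod_cast h2
  obtain ⟨c, hc⟩ := hc
  set φ : Polynomial ℤ := MvPolynomial.aeval ![Polynomial.X, 1 + Polynomial.C c * Polynomial.X] f
    with hφ
  have hφev : ∀ (A : Type) [CommRing A] (w : A), Polynomial.aeval w φ =
      MvPolynomial.aeval ![w, 1 + c * w] f := by
    intro A _ w
    rw [hφ, aeval_comp_poly]
    simp
  have hφn : φ.natDegree ≤ n := by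
    have := MvPolynomial.aeval_natDegree_le (m := n) (n := 1) f hf.totalDegree_le
      ![Polynomial.X, 1 + Polynomial.C c * Polynomial.X] (by
        intro i
        fin_cases i
        · simp
        · change (1 + Polynomial.C c * Polynomial.X : Polynomial ℤ).natDegree ≤ 1
          compute_degree)
    rwa [mul_one] at this
  have hhz : ∀ x y : ℤ, y ≠ 0 → hz φ n x y = MvPolynomial.aeval ![x, y + c * x] f := by
    intro x y hy
    have hyQ : (y : ℚ) ≠ 0 := by exact_mod_cast hy
    have h1 := hz_cast φ n x y hφn hyQ
    rw [hφev, ← homog_smul2 f n hf, mul_div_cancel₀ _ hyQ,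
      show (y : ℚ) * (1 + c * (x / y)) = ((y + c * x : ℤ) : ℚ) by push_cast; field_simp,
      ← aeval_cast] at h1
    exact_mod_cast h1
  have hCev : ∀ u v : ℂ, MvPolynomial.aeval ![u, v] f =
      (∏ i, (a i * u + b i * v)) * MvPolynomial.eval ![u, v] g := by
    intro u v
    have h1 := congrArg (MvPolynomial.eval ![u, v]) hfact
    rw [MvPolynomial.eval_map, map_mul, map_prod] at h1
    rw [MvPolynomial.aeval_def, show algebraMap ℤ ℂ = Int.castRingHom ℂ from rfl, h1]
    simp
  have hab : ∀ i, a i + b i * c ≠ 0 := by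
    intro i h0
    have h1 := aeval_cast (A := ℂ) f 1 c
    rw [hCev, Int.cast_one] at h1
    have h2 : ∏ i, (a i * 1 + b i * (c : ℂ)) = 0 :=
      Finset.prod_eq_zero (Finset.mem_univ i) (by rw [mul_one, h0])
    rw [h2, zero_mul] at h1
    exact hc (by exact_mod_cast h1)
  set ρ : Fin 3 → ℂ := fun i => -b i / (a i + b i * c) with hρ
  have hρinj : Function.Injective ρ := by
    intro i j hij
    by_contra hne
    simp only [hρ] at hij
    rw [div_eq_div_iff (hab i) (hab j)] at hij
    exact hprop i j hne (by linear_combination hij)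
  have hρroot : ∀ i, Polynomial.aeval (ρ i) φ = 0 := by
    intro i
    rw [hφev, hCev]
    have : ∏ l, (a l * ρ i + b l * (1 + c * ρ i)) = 0 :=
      Finset.prod_eq_zero (Finset.mem_univ i) (by
        simp only [hρ]
        field_simp [hab i]
        ring)
    rw [this, zero_mul]
  have hφ0 : φ ≠ 0 := by
    intro h0
    have hall : ∀ d : ℤ, d ≠ c → MvPolynomial.aeval ![(1 : ℤ), d] f = 0 := by
      intro d hd
      have := hhz 1 (d - c) (sub_ne_zero.2 hd)
      rw [h0] at this
      simp only [hz, Polynomial.coeff_zero, zero_mul, Finset.sum_const_zero] at this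
      rw [show d - c + c * 1 = d by ring] at this
      exact this.symm
    have hψ : MvPolynomial.aeval ![(1 : Polynomial ℤ), Polynomial.X] f = 0 := by
      refine Polynomial.eq_zero_of_infinite_isRoot _ ?_
      refine Set.Infinite.mono ?_ (Set.finite_singleton c).infinite_compl
      intro d hd
      have := aeval_comp_poly f 1 Polynomial.X d
      rw [map_one, Polynomial.aeval_X, hall d hd, Polynomial.coe_aeval_eq_eval] at this
      exact this
    have := aeval_comp_poly f 1 Polynomial.X c
    rw [hψ, map_zero, map_one, Polynomial.aeval_X] at this
    exact hc this.symm
  obtain ⟨h, g', M, hM, hfac, hdeg, hsep⟩ := sqfree_part φ hφ0 (Finset.univ.image ρ)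
    (by rw [Finset.card_image_of_injective _ hρinj]; simp) (by
      intro z hz
      obtain ⟨i, -, rfl⟩ := Finset.mem_image.1 hz
      exact hρroot i)
  have hfin1 := (thue_finite p hpinj h hdeg hsep (M * k) (mul_ne_zero hM hk)).image
    (fun s : ℤ × ℤ => (s.1, s.2 + c * s.1))
  have hfin2 := (Set.finite_Icc (-|k|) |k|).image (fun x : ℤ => (x, c * x))
  refine (hfin1.union hfin2).subset ?_
  rintro ⟨x, y⟩ ⟨hx, hpx, z, hzv⟩
  dsimp only at hx hpx hzv
  by_cases hy : y - c * x = 0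
  · right
    have hyc : y = c * x := by linarith
    refine ⟨x, ?_, by rw [hyc]⟩
    by_cases hn0 : n = 0
    · exfalso
      have h3 : φ.natDegree = 0 := by omega
      have h4 := congrArg Polynomial.natDegree hfac
      rw [Polynomial.natDegree_C_mul hM, Polynomial.natDegree_mul, h3] at h4
      · omega
      · rintro rfl; simp at hdeg
      · rintro rfl
        rw [mul_zero] at hfac
        exact mul_ne_zero (Polynomial.C_ne_zero.2 hM) hφ0 hfac
    have h1 : x ∣ k * ∏ i, (p i : ℤ) ^ z i := by
      rw [← hzv, hyc]
      have := homog_smul2 f n hf x 1 c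
      rw [mul_one, mul_comm x c] at this
      rw [this]
      exact (dvd_pow_self x hn0).mul_right _
    have h2 : IsCoprime x (∏ i, (p i : ℤ) ^ z i) := by
      refine IsCoprime.prod_right fun i _ => IsCoprime.pow_right ?_
      exact ((Nat.prime_iff_prime_int.1 (hp i).out).coprime_iff_not_dvd.2 (hpx i)).symm
    have h3 : x ∣ k := h2.dvd_of_dvd_mul_right h1
    have h4 : |x| ≤ |k| := Int.le_of_dvd (abs_pos.2 hk) ((abs_dvd_abs _ _).2 h3)
    exact abs_le.1 h4
  · left
    have hval : hz φ n x (y - c * x) = k * ∏ i, (p i : ℤ) ^ z i := by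
      rw [hhz _ _ hy, ← hzv]
      congr 3
      ring_nf
    have hd := hz_mul h g' φ M hM hφ0 hfac n hφn x (y - c * x) hy
    rw [hval] at hd
    refine ⟨(x, y - c * x), ⟨hy, ?_, hpx, z, by rwa [mul_assoc]⟩, ?_⟩
    · exact ne_zero_of_dvd_ne_zero (mul_ne_zero hM (hne z)) hd
    · simp

theorem stmt_18 (f : MvPolynomial (Fin 2) ℤ) (n : ℕ) (hf : f.IsHomogeneous n)
    (a b : Fin 3 → ℂ) (g : MvPolynomial (Fin 2) ℂ)
    (hfact : f.map (Int.castRingHom ℂ) =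
      (∏ i, (C (a i) * X 0 + C (b i) * X 1)) * g)
    (hprop : ∀ i j, i ≠ j → a i * b j ≠ a j * b i)
    (k : ℤ) (hk : k ≠ 0) (t : ℕ) (p : Fin t → ℕ)
    (hp : ∀ i, (p i).Prime) (hpinj : Function.Injective p) :
    {s : ℤ × ℤ × (Fin t → ℕ) |
      MvPolynomial.eval (fun i : Fin 2 => if i = 0 then s.1 else s.2.1) f =
        k * ∏ i, (p i : ℤ) ^ (s.2.2 i) ∧
      s.1 * s.2.1 ≠ 0 ∧ Int.gcd (s.1 * s.2.1) (∏ i, (p i : ℤ)) = 1}.Finite := by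
  haveI : ∀ i, Fact (p i).Prime := fun i => ⟨hp i⟩
  have hfin := pairs_finite f n hf a b g hfact hprop k hk t p hpinj
  have hfin2 := hfin.biUnion (t := fun q => (fun z : Fin t → ℕ => (q.1, q.2, z)) ''
    Set.Icc (0 : Fin t → ℕ) (fun _ => (MvPolynomial.aeval ![q.1, q.2] f : ℤ).natAbs))
    (fun q _ => (Set.finite_Icc _ _).image _)
  refine hfin2.subset ?_
  rintro ⟨x, y, z⟩ ⟨hz, hxy, hgcd⟩
  dsimp only at hz hxy hgcd
  have hev : (fun i : Fin 2 => if i = 0 then x else y) = ![x, y] := by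
    funext i
    fin_cases i <;> rfl
  rw [hev, ← MvPolynomial.coe_aeval_eq_eval] at hz
  change MvPolynomial.aeval ![x, y] f = _ at hz
  have hpx : ∀ i, ¬ (p i : ℤ) ∣ x := by
    intro i hi
    have h1 : (p i : ℤ) ∣ Int.gcd (x * y) (∏ i, (p i : ℤ)) :=
      Int.dvd_coe_gcd (hi.mul_right y) (Finset.dvd_prod_of_mem _ (Finset.mem_univ i))
    rw [hgcd] at h1
    exact (hp i).one_lt.ne' (by exact_mod_cast Int.eq_one_of_dvd_one (by positivity) h1)
  refine Set.mem_biUnion (x := (x, y)) ⟨left_ne_zero_of_mul hxy, hpx, z, hz⟩ ⟨z, ?_, rfl⟩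
  refine ⟨fun i => Nat.zero_le _, fun i => ?_⟩
  have hne : k * ∏ i, (p i : ℤ) ^ z i ≠ 0 :=
    mul_ne_zero hk (Finset.prod_ne_zero_iff.2 fun i _ =>
      pow_ne_zero _ (by exact_mod_cast (hp i).ne_zero))
  have hdv : ((p i ^ z i : ℕ) : ℤ) ∣ k * ∏ i, (p i : ℤ) ^ z i := by
    push_cast
    exact (Finset.dvd_prod_of_mem (fun i => (p i : ℤ) ^ z i) (Finset.mem_univ i)).mul_left _
  have h1 := Nat.le_of_dvd (Int.natAbs_pos.2 hne) (Int.natCast_dvd.1 hdv)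
  change z i ≤ (MvPolynomial.aeval ![x, y] f : ℤ).natAbs
  rw [hz]
  exact ((Nat.lt_pow_self (hp i).one_lt).le).trans h1
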